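/- arXiv:2510.11768 — 7 statements merged into one kernel-verified Lean document; each statement's English description precedes it below -/
import Mathlib

section
/- Let a, u be coprime positive integers with a ≠ u, Δ := u² − a², A₀ := a²u². If the element Δ_S := (17 − 12√2)Δ² + 4A₀ of K = ℚ(√2) is a square in K, then, setting y := au/Δ ∈ ℚ, there exists v ∈ ℚ with v² = 16y⁴ + 136y² + 1. -/
open Polynomial IntermediateField

/-- `K = ℚ(√2)`, realized as the intermediate field of `ℝ` generated over `ℚ` by `√2`. -/
noncomputable def K : IntermediateField ℚ ℝ := ℚ⟮(Real.sqrt 2 : ℝ)⟯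

/-- The element `√2` of `K = ℚ(√2)`. -/
noncomputable def sqrt2 : K :=
  ⟨Real.sqrt 2, by unfold K; exact IntermediateField.mem_adjoin_simple_self ℚ _⟩

/-- Every element of `ℚ(√2)` has the form `p + q√2` with `p`, `q` rational. -/
theorem exists_rat_add_mul_sqrt_two {x : ℝ} (hx : x ∈ K) :
    ∃ p q : ℚ, x = p + q * Real.sqrt 2 := by
  have hint : IsIntegral ℚ (Real.sqrt 2) :=
    ⟨X ^ 2 - 2, by monicity!, by simp⟩
  have hx' : x ∈ Algebra.adjoin ℚ {Real.sqrt 2} := by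
    rw [← adjoin_simple_toSubalgebra_of_isAlgebraic hint.isAlgebraic]
    exact hx
  clear hx
  induction hx' using Algebra.adjoin_induction with
  | mem x h => exact ⟨0, 1, by simpa using h⟩
  | algebraMap r => exact ⟨r, 0, by simp⟩
  | add x y _ _ hx hy =>
    obtain ⟨p, q, rfl⟩ := hx
    obtain ⟨r, s, rfl⟩ := hy
    exact ⟨p + r, q + s, by push_cast; ring⟩
  | mul x y _ _ hx hy =>
    obtain ⟨p, q, rfl⟩ := hx
    obtain ⟨r, s, rfl⟩ := hy
    refine ⟨p * r + 2 * q * s, p * s + q * r, ?_⟩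
    push_cast
    linear_combination (q * s : ℝ) * Real.sq_sqrt (zero_le_two (α := ℝ))

/-- Rational coordinates with respect to `1, √2` are unique. -/
theorem rat_add_mul_sqrt_two_inj {p q r s : ℚ}
    (h : (p + q * Real.sqrt 2 : ℝ) = r + s * Real.sqrt 2) : p = r ∧ q = s := by
  have hqs : q = s := by
    by_contra hne
    have hne' : (q - s : ℝ) ≠ 0 := sub_ne_zero.mpr (by exact_mod_cast hne)
    refine irrational_sqrt_two ⟨(r - p) / (q - s), ?_⟩
    push_cast
    rw [div_eq_iff hne']
    linear_combination -h
  subst hqs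
  exact ⟨by exact_mod_cast add_right_cancel h, rfl⟩

/-- if `Δ_S` is a square in `K`, then with `y = au/Δ` there is a rational point
`(y, v)` on the quartic `v² = 16y⁴ + 136y² + 1`. -/
theorem stmt_3 (a u : ℕ) (ha : 0 < a) (hu : 0 < u) (hau : a ≠ u) (hcop : Nat.Coprime a u)
    (Δ A₀ : ℚ) (hΔ : Δ = (u : ℚ) ^ 2 - (a : ℚ) ^ 2) (hA₀ : A₀ = (a : ℚ) ^ 2 * (u : ℚ) ^ 2)
    (hsq : IsSquare (((17 : K) - 12 * sqrt2) * (Δ : K) ^ 2 + 4 * (A₀ : K)))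
    (y : ℚ) (hy : y = (a * u : ℚ) / Δ) :
    ∃ v : ℚ, v ^ 2 = 16 * y ^ 4 + 136 * y ^ 2 + 1 := by
  have hΔ0 : Δ ≠ 0 := by
    rw [hΔ, sub_ne_zero]
    intro h
    have h' : u ^ 2 = a ^ 2 := by exact_mod_cast h
    exact hau (Nat.pow_left_injective two_ne_zero h').symm
  obtain ⟨s, hs⟩ := hsq
  obtain ⟨p, q, hpq⟩ := exists_rat_add_mul_sqrt_two s.2
  have hreal : (17 - 12 * Real.sqrt 2) * (Δ : ℝ) ^ 2 + 4 * (A₀ : ℝ) = (s : ℝ) * s :=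
    congrArg (Subtype.val : K → ℝ) hs
  rw [hpq] at hreal
  obtain ⟨h1, h2⟩ := rat_add_mul_sqrt_two_inj (p := 17 * Δ ^ 2 + 4 * A₀) (q := -12 * Δ ^ 2)
    (r := p ^ 2 + 2 * q ^ 2) (s := 2 * p * q) (by
      push_cast
      linear_combination hreal + (q ^ 2 : ℝ) * Real.sq_sqrt (zero_le_two (α := ℝ)))
  have hnorm : (p ^ 2 - 2 * q ^ 2) ^ 2 = 16 * A₀ ^ 2 + 136 * A₀ * Δ ^ 2 + Δ ^ 4 := by
    linear_combination -(17 * Δ ^ 2 + 4 * A₀ + p ^ 2 + 2 * q ^ 2) * h1 +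
      2 * (-12 * Δ ^ 2 + 2 * p * q) * h2
  refine ⟨(p ^ 2 - 2 * q ^ 2) / Δ ^ 2, ?_⟩
  rw [div_pow, hnorm, hy, hA₀]
  field_simp
end

section
/- The group of ℚ-rational points of the elliptic curve E : Y² = X³ − 17X² + 72X (equivalently Y² = X(X−8)(X−9)) is finite of order exactly 8; in particular E has Mordell–Weil rank 0 over ℚ. -/
/-- The elliptic curve `E : Y² = X³ − 17X² + 72X = X(X−8)(X−9)` over `ℚ`. -/
def E : WeierstrassCurve ℚ := ⟨0, -17, 0, 72, 0⟩

/-- The pairs of nonzero integers `(c, t)` for which `c² + t²` and `c² + 9t²` are both squares. -/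
def Concordant (c t : ℤ) : Prop :=
  c ≠ 0 ∧ t ≠ 0 ∧ IsSquare (c ^ 2 + t ^ 2) ∧ IsSquare (c ^ 2 + 9 * t ^ 2)

theorem Int.isSquare_of_isSquare_sq_mul {g n : ℤ} (hg : g ≠ 0) (h : IsSquare (g ^ 2 * n)) :
    IsSquare n := by
  obtain ⟨r, hr⟩ := h
  obtain ⟨s, rfl⟩ : g ∣ r := (Int.pow_dvd_pow_iff two_ne_zero).1 ⟨n, by rw [hr]; ring⟩
  exact ⟨s, mul_left_cancel₀ (pow_ne_zero 2 hg) (by rw [hr]; ring)⟩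

theorem Int.exists_four_factors {m n p q : ℤ} (hp : p ≠ 0) (h : p * q = m * n) :
    ∃ α β γ δ, m = α * β ∧ n = γ * δ ∧ p = α * γ ∧ q = β * δ := by
  obtain ⟨α, γ, ⟨β, rfl⟩, ⟨δ, rfl⟩, rfl⟩ := exists_dvd_and_dvd_of_dvd_mul (Dvd.intro q h)
  exact ⟨α, β, γ, δ, rfl, rfl, rfl, mul_left_cancel₀ hp (by rw [h]; ring)⟩

theorem Int.exists_common_cofactor {x y P Q : ℤ} (hx : x ≠ 0) (hxy : IsCoprime x y)
    (h : x ^ 2 * P = y ^ 2 * Q) : ∃ k, P = k * y ^ 2 ∧ Q = k * x ^ 2 := by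
  obtain ⟨k, rfl⟩ : x ^ 2 ∣ Q := hxy.pow.dvd_of_dvd_mul_left ⟨P, h.symm⟩
  exact ⟨k, mul_left_cancel₀ (pow_ne_zero 2 hx) (by rw [h]; ring), mul_comm _ _⟩

theorem Int.dvd_of_dvd_mul_sq {k d x y : ℤ} (hxy : IsCoprime x y) (hx : k ∣ d * x ^ 2)
    (hy : k ∣ d * y ^ 2) : k ∣ d := by
  obtain ⟨u, v, huv⟩ : IsCoprime (x ^ 2) (y ^ 2) := hxy.pow
  have : d = u * (d * x ^ 2) + v * (d * y ^ 2) := by linear_combination -d * huv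
  rw [this]
  exact dvd_add (hx.mul_left u) (hy.mul_left v)

theorem Int.dvd_eight {k : ℤ} (h : k ∣ 8) :
    k = 1 ∨ k = 2 ∨ k = 4 ∨ k = 8 ∨ k = -1 ∨ k = -2 ∨ k = -4 ∨ k = -8 := by
  have h1 := Int.le_of_dvd (by norm_num) h
  have h2 := Int.le_of_dvd (by norm_num) (neg_dvd.2 h)
  have h3 : -8 ≤ k := by omega
  interval_cases k <;> revert h <;> decide

theorem Int.sq_emod_three (x : ℤ) : (3 ∣ x ∧ x ^ 2 % 3 = 0) ∨ (¬ 3 ∣ x ∧ x ^ 2 % 3 = 1) := by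
  have : x % 3 = 0 ∨ x % 3 = 1 ∨ x % 3 = 2 := by omega
  rcases this with h | h | h <;> simp [pow_two, Int.mul_emod, h] <;> omega

theorem Int.sq_emod_eight (x : ℤ) :
    (x % 2 = 0 ∧ (x ^ 2 % 8 = 0 ∨ x ^ 2 % 8 = 4)) ∨ (x % 2 = 1 ∧ x ^ 2 % 8 = 1) := by
  have : x % 8 = 0 ∨ x % 8 = 1 ∨ x % 8 = 2 ∨ x % 8 = 3 ∨ x % 8 = 4 ∨ x % 8 = 5 ∨ x % 8 = 6 ∨
    x % 8 = 7 := by omega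
  rcases this with h | h | h | h | h | h | h | h <;> simp [pow_two, Int.mul_emod, h] <;> omega

theorem IsCoprime.not_two_dvd {a b : ℤ} (h : IsCoprime a b) : ¬ (a % 2 = 0 ∧ b % 2 = 0) := by
  rintro ⟨ha, hb⟩
  have := Int.isUnit_iff.1 (h.isUnit_of_dvd' (Int.dvd_of_emod_eq_zero ha)
    (Int.dvd_of_emod_eq_zero hb))
  omega

theorem IsCoprime.not_three_dvd {a b : ℤ} (h : IsCoprime a b) : ¬ (3 ∣ a ∧ 3 ∣ b) := by
  rintro ⟨ha, hb⟩
  have := Int.isUnit_iff.1 (h.isUnit_of_dvd' ha hb)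
  omega

namespace Concordant

theorem of_mul {g c t : ℤ} (hg : g ≠ 0) (h : Concordant (g * c) (g * t)) : Concordant c t := by
  obtain ⟨hc, ht, h1, h2⟩ := h
  refine ⟨right_ne_zero_of_mul hc, right_ne_zero_of_mul ht,
    Int.isSquare_of_isSquare_sq_mul hg ?_, Int.isSquare_of_isSquare_sq_mul hg ?_⟩
  · convert h1 using 1; ring
  · convert h2 using 1; ring

theorem of_three_mul {c t : ℤ} (h : Concordant (3 * c) t) : Concordant t c := by
  obtain ⟨hc, ht, h1, h2⟩ := h
  refine ⟨ht, right_ne_zero_of_mul hc,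
    Int.isSquare_of_isSquare_sq_mul (g := 3) (by norm_num) ?_, ?_⟩
  · convert h2 using 1; ring
  · convert h1 using 1; ring

theorem isCoprime_factors {α β γ δ : ℤ} (h : IsCoprime (α * β) (γ * δ)) :
    IsCoprime α δ ∧ IsCoprime β γ :=
  ⟨h.of_mul_left_left.of_mul_right_right, h.of_mul_left_right.of_mul_right_left⟩

/-- Primitive Pythagorean triples with odd first leg. -/
theorem parametrize {x y : ℤ} (hxy : IsCoprime x y) (hx : x % 2 = 1) (hy : y ≠ 0)
    (h : IsSquare (x ^ 2 + y ^ 2)) :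
    ∃ m n, x = m ^ 2 - n ^ 2 ∧ y = 2 * m * n ∧ IsCoprime m n ∧ (m * n) % 2 = 0 := by
  obtain ⟨z, hz⟩ := h
  have hz0 : z ≠ 0 := by rintro rfl; nlinarith [sq_nonneg x, sq_pos_of_ne_zero hy]
  have hP : PythagoreanTriple x y |z| := by
    rw [PythagoreanTriple, abs_mul_abs_self]; linarith
  obtain ⟨m, n, h1, h2, -, h3, h4, -⟩ := hP.coprime_classification'
    (Int.isCoprime_iff_gcd_eq_one.1 hxy) hx (abs_pos.2 hz0)
  refine ⟨m, n, h1, h2, Int.isCoprime_iff_gcd_eq_one.2 h3, ?_⟩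
  rcases h4 with ⟨h, h'⟩ | ⟨h, h'⟩ <;> simp [Int.mul_emod, h, h']

/-- For even `c` the factorisation of the two triangles leaves no residue class modulo `3` and
`8`. -/
theorem false_of_even {c t : ℤ} (h : Concordant c t) (hct : IsCoprime c t)
    (h3 : ¬ 3 ∣ c) (hc : c % 2 = 0) : False := by
  obtain ⟨hc0, ht0, h1, h2⟩ := h
  have ht : t % 2 = 1 := by
    have := hct.not_two_dvd
    omega
  have hc3 : IsCoprime 3 c := (Int.prime_three.coprime_iff_not_dvd).2 h3
  obtain ⟨m, n, e1, e2, hmn, hpar⟩ := parametrize hct.symm ht hc0 (by rwa [add_comm])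
  obtain ⟨p, q, e3, e4, hpq, -⟩ := parametrize (x := 3 * t) (y := c) (hc3.mul_left hct.symm)
    (by omega) hc0 (by convert h2 using 1; ring)
  have hp0 : p ≠ 0 := by rintro rfl; simp at e4; exact hc0 e4
  obtain ⟨α, β, γ, δ, rfl, rfl, rfl, rfl⟩ := Int.exists_four_factors (m := m) (n := n) hp0
    (q := q) (by linarith)
  obtain ⟨hαδ, hβγ⟩ := isCoprime_factors hmn
  have hα0 : α ≠ 0 := by rintro rfl; simp at hp0
  obtain ⟨k, k1, k2⟩ := Int.exists_common_cofactor (P := γ ^ 2 - 3 * β ^ 2)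
    (Q := β ^ 2 - 3 * γ ^ 2) hα0 hαδ (by linear_combination -e3 + 3 * e1)
  have hk : k ∣ 8 := Int.dvd_of_dvd_mul_sq hβγ
    ⟨-α ^ 2 - 3 * δ ^ 2, by linear_combination -k2 - 3 * k1⟩
    ⟨-δ ^ 2 - 3 * α ^ 2, by linear_combination -k1 - 3 * k2⟩
  have hneg : k < 0 := by
    by_contra! hk0
    have hβ0 : β ≠ 0 := by rintro rfl; simp at e2; exact hc0 e2
    nlinarith [mul_nonneg hk0 (sq_nonneg δ), mul_nonneg hk0 (sq_nonneg α), sq_pos_of_ne_zero hβ0,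
      sq_nonneg γ]
  have hmod3 : k ≠ -1 ∧ k ≠ -4 := by
    have hβγ3 := hβγ.not_three_dvd
    have a3 := Int.sq_emod_three α
    have b3 := Int.sq_emod_three β
    have c3 := Int.sq_emod_three γ
    have d3 := Int.sq_emod_three δ
    constructor <;> rintro rfl <;> omega
  have hmod8 : k ≠ -2 ∧ k ≠ -8 := by
    have hβγ2 := hβγ.not_two_dvd
    have a8 := Int.sq_emod_eight α
    have b8 := Int.sq_emod_eight β
    have c8 := Int.sq_emod_eight γ
    have d8 := Int.sq_emod_eight δ
    refine ⟨?_, ?_⟩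
    · rintro rfl
      have : β % 2 = 1 ∧ γ % 2 = 1 := by omega
      have : α % 2 = 1 ∧ δ % 2 = 1 := by omega
      simp_all [Int.mul_emod]
    · rintro rfl
      omega
  have := Int.dvd_eight hk
  omega

/-- For odd `c` the factors of the two triangles form a smaller concordant pair. -/
theorem descent_of_odd {c t : ℤ} (h : Concordant c t) (hct : IsCoprime c t)
    (h3 : ¬ 3 ∣ c) (hc : c % 2 = 1) : ∃ x y, Concordant x y ∧ (x * y).natAbs < (c * t).natAbs := by
  obtain ⟨hc0, ht0, h1, h2⟩ := h
  have hc3 : IsCoprime 3 c := (Int.prime_three.coprime_iff_not_dvd).2 h3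
  obtain ⟨m, n, e1, e2, hmn, hpar⟩ := parametrize hct hc ht0 h1
  obtain ⟨p, q, e3, e4, hpq, -⟩ := parametrize (x := c) (y := 3 * t) (hc3.symm.mul_right hct)
    hc (by omega) (by convert h2 using 1; ring)
  have hlt (x y z w : ℤ) (ht : t = 2 * (x * y * (z * w))) : (x * y).natAbs < (c * t).natAbs := by
    have h0 : x * y ≠ 0 ∧ z * w ≠ 0 := by
      constructor <;> intro h <;> simp [h] at ht <;> exact ht0 ht
    rw [Int.natAbs_mul c, ht, Int.natAbs_mul 2, Int.natAbs_mul (x * y)]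
    have := Int.natAbs_pos.2 hc0
    have := Int.natAbs_pos.2 h0.1
    have := Int.natAbs_pos.2 h0.2
    have h5 : (x * y).natAbs * 1 ≤ (x * y).natAbs * (z * w).natAbs := Nat.mul_le_mul_left _ this
    calc (x * y).natAbs < 1 * (2 * ((x * y).natAbs * (z * w).natAbs)) := by omega
      _ ≤ _ := Nat.mul_le_mul (by omega) (by simp)
  have hpq3 : p * q = 3 * (m * n) := by linarith
  have hne : p ≠ 0 ∧ q ≠ 0 := by
    constructor <;> rintro rfl <;> simp at e4 <;> exact ht0 e4
  rcases Int.prime_three.dvd_or_dvd (Dvd.intro _ hpq3.symm) with ⟨r, rfl⟩ | ⟨r, rfl⟩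
  · obtain ⟨α, β, γ, δ, rfl, rfl, rfl, rfl⟩ := Int.exists_four_factors (m := m) (n := n)
      (p := r) (q := q) (by rintro rfl; simp at hne) (by linarith)
    obtain ⟨hαδ, hβγ⟩ := isCoprime_factors hmn
    have hα0 : α ≠ 0 := by rintro rfl; simp at hne
    have hγ0 : γ ≠ 0 := by rintro rfl; simp at hne
    have hδ0 : δ ≠ 0 := by rintro rfl; simp at hne
    have h3β : ¬ 3 ∣ β := fun h => by
      have := hpq.not_three_dvd
      exact this ⟨Dvd.intro _ rfl, h.mul_right _⟩
    obtain ⟨k, k1, k2⟩ := Int.exists_common_cofactor (P := β ^ 2 - 9 * γ ^ 2)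
      (Q := γ ^ 2 - β ^ 2) hα0 hαδ (by linear_combination e3 - e1)
    have hk : k ∣ 8 := Int.dvd_of_dvd_mul_sq hβγ
      ⟨-δ ^ 2 - 9 * α ^ 2, by linear_combination -k1 - 9 * k2⟩
      ⟨-δ ^ 2 - α ^ 2, by linear_combination -k1 - k2⟩
    have hneg : k < 0 := by
      by_contra! hk0
      nlinarith [mul_nonneg hk0 (sq_nonneg δ), mul_nonneg hk0 (sq_nonneg α),
        sq_pos_of_ne_zero hγ0]
    have hmod3 : k ≠ -1 ∧ k ≠ -4 := by
      have b3 := Int.sq_emod_three β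
      have d3 := Int.sq_emod_three δ
      constructor <;> rintro rfl <;> omega
    have hmod8 : k ≠ -2 := by
      have hβγ2 := hβγ.not_two_dvd
      have hαδ2 := hαδ.not_two_dvd
      have a8 := Int.sq_emod_eight α
      have b8 := Int.sq_emod_eight β
      have c8 := Int.sq_emod_eight γ
      have d8 := Int.sq_emod_eight δ
      rintro rfl
      have : β % 2 = 1 ∧ γ % 2 = 1 := by omega
      omega
    obtain rfl : k = -8 := by
      have := Int.dvd_eight hk
      omega
    exact ⟨δ, α, ⟨hδ0, hα0, ⟨γ, by linarith⟩, ⟨β, by linarith⟩⟩,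
      hlt δ α γ β (by rw [e2]; ring)⟩
  · obtain ⟨α, β, γ, δ, rfl, rfl, rfl, rfl⟩ := Int.exists_four_factors (m := m) (n := n)
      (p := p) (q := r) hne.1 (by linarith)
    obtain ⟨hαδ, hβγ⟩ := isCoprime_factors hmn
    have hα0 : α ≠ 0 := by rintro rfl; simp at hne
    have hβ0 : β ≠ 0 := by rintro rfl; simp at hne
    have hδ0 : δ ≠ 0 := by rintro rfl; simp at hne
    obtain ⟨k, k1, k2⟩ := Int.exists_common_cofactor (P := α ^ 2 + 9 * δ ^ 2)
      (Q := α ^ 2 + δ ^ 2) hβ0 hβγ (by linear_combination e3 - e1)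
    have hk : k ∣ 8 := Int.dvd_of_dvd_mul_sq hαδ
      ⟨9 * β ^ 2 - γ ^ 2, by linear_combination 9 * k2 - k1⟩
      ⟨γ ^ 2 - β ^ 2, by linear_combination k1 - k2⟩
    have hpos : 0 < k := by
      by_contra! hk0
      nlinarith [mul_nonneg (neg_nonneg.2 hk0) (sq_nonneg β), sq_pos_of_ne_zero hα0, sq_nonneg δ]
    have hmod8 : k ≠ 2 ∧ k ≠ 4 ∧ k ≠ 8 := by
      have hαδ2 := hαδ.not_two_dvd
      have a8 := Int.sq_emod_eight α
      have b8 := Int.sq_emod_eight β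
      have c8 := Int.sq_emod_eight γ
      have d8 := Int.sq_emod_eight δ
      refine ⟨?_, ?_, ?_⟩
      · rintro rfl
        have h1 : α % 2 = 1 ∧ δ % 2 = 1 := by omega
        have h2 : β % 2 = 1 ∧ γ % 2 = 1 := by omega
        simp_all [Int.mul_emod]
      · rintro rfl
        omega
      · rintro rfl
        omega
    obtain rfl : k = 1 := by
      have := Int.dvd_eight hk
      omega
    exact ⟨α, δ, ⟨hα0, hδ0, ⟨β, by linarith⟩, ⟨γ, by linarith⟩⟩,
      hlt α δ β γ (by rw [e2]; ring)⟩

end Concordant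

/-- There is no solution `c, t ≠ 0` of `c² + t² = □`, `c² + 9t² = □`. -/
theorem not_concordant (c t : ℤ) : ¬ Concordant c t := by
  induction hN : (c * t).natAbs using Nat.strong_induction_on generalizing c t with
  | _ N ih =>
  subst hN
  intro h
  have hpos : 0 < (c * t).natAbs := Int.natAbs_pos.2 (mul_ne_zero h.1 h.2.1)
  by_cases hct : IsCoprime c t
  · by_cases h3 : 3 ∣ c
    · obtain ⟨d, rfl⟩ := h3
      refine ih _ ?_ _ _ rfl h.of_three_mul
      have e : 3 * d * t = 3 * (t * d) := by ring
      omega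
    · rcases Int.emod_two_eq_zero_or_one c with hc | hc
      · exact h.false_of_even hct h3 hc
      · obtain ⟨x, y, hxy, hlt⟩ := h.descent_of_odd hct h3 hc
        exact ih _ hlt _ _ rfl hxy
  · obtain ⟨g, hg, ⟨x, rfl⟩, ⟨y, rfl⟩⟩ : ∃ g : ℤ, 2 ≤ g ∧ g ∣ c ∧ g ∣ t := by
      refine ⟨Int.gcd c t, ?_, Int.gcd_dvd_left .., Int.gcd_dvd_right ..⟩
      have := mt Int.isCoprime_iff_gcd_eq_one.2 hct
      have : Int.gcd c t ≠ 0 := fun h0 => h.1 (Int.gcd_eq_zero_iff.1 h0).1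
      omega
    refine ih _ ?_ _ _ rfl (h.of_mul (by omega))
    have e : g * x * (g * y) = g * g * (x * y) := by ring
    rw [e, Int.natAbs_mul (g * g)] at hpos ⊢
    have : 2 ≤ (g * g).natAbs := by
      have : 2 * 2 ≤ g * g := mul_le_mul hg hg (by norm_num) (by omega)
      omega
    nlinarith [Nat.pos_of_mul_pos_left hpos, Nat.mul_le_mul_right (x * y).natAbs this]

theorem Int.exists_squarefree_mul_sq {n : ℤ} (hn : n ≠ 0) :
    ∃ u s : ℤ, Squarefree u ∧ s ≠ 0 ∧ n = u * s ^ 2 := by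
  obtain ⟨u, s, hus, hu⟩ := Nat.sq_mul_squarefree n.natAbs
  have hs : (s : ℤ) ≠ 0 := by
    rintro hs
    have : s = 0 := by exact_mod_cast hs
    subst this
    simp at hus
    omega
  have hn' : (s : ℤ) ^ 2 * u = |n| := by rw [← Int.natCast_natAbs, ← hus]; push_cast; rfl
  rcases abs_choice n with h | h
  · exact ⟨u, s, Int.squarefree_natCast.2 hu, hs, by linarith⟩
  · exact ⟨-u, s, Int.squarefree_natAbs.1 (by simpa using hu), hs, by linarith⟩

/-- If `u` is squarefree and `u s² m` is a square, then `u` divides the cofactor `m`. -/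
theorem Squarefree.dvd_of_mul_sq_mul_eq_sq {u s m B : ℤ} (hu : Squarefree u) (hs : s ≠ 0)
    (h : u * s ^ 2 * m = B ^ 2) : u ∣ m := by
  obtain ⟨C, rfl⟩ : s ∣ B := (Int.pow_dvd_pow_iff two_ne_zero).1 ⟨u * m, by rw [← h]; ring⟩
  have hC : u * m = C ^ 2 := mul_left_cancel₀ (pow_ne_zero 2 hs) (by linear_combination h)
  obtain ⟨e, rfl⟩ : u ∣ C := (hu.dvd_pow_iff_dvd two_ne_zero).1 (Dvd.intro _ hC)
  exact ⟨e ^ 2, mul_left_cancel₀ hu.ne_zero (by rw [hC]; ring)⟩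

theorem Int.dvd_two_cases {v : ℤ} (h : v ∣ 2) : v = 1 ∨ v = 2 ∨ v = -1 ∨ v = -2 := by
  have := Int.dvd_eight (h.trans (by norm_num))
  rcases this with h | h | h | h | h | h | h | h <;> subst h <;> revert h <;> decide

theorem Int.dvd_three_cases {w : ℤ} (h : w ∣ 3) : w = 1 ∨ w = 3 ∨ w = -1 ∨ w = -3 := by
  have h1 := Int.le_of_dvd (by norm_num) h
  have h2 := Int.le_of_dvd (by norm_num) (neg_dvd.2 h)
  have h3 : -3 ≤ w := by omega
  interval_cases w <;> revert h <;> decide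

theorem Int.pos_dvd_six_cases {u : ℤ} (hu : 0 < u) (h : u ∣ 6) :
    u = 1 ∨ u = 2 ∨ u = 3 ∨ u = 6 := by
  have h1 := Int.le_of_dvd (by norm_num) h
  interval_cases u <;> revert h <;> decide

/-- The signed squarefree triples with square product. -/
theorem square_class_cases {u v w : ℤ} (hu : 0 < u) (hu6 : u ∣ 6) (hv2 : v ∣ 2) (hw3 : w ∣ 3)
    (huvw : IsSquare (u * v * w)) :
    (u = 1 ∧ (v = 1 ∧ w = 1 ∨ v = -1 ∧ w = -1)) ∨
      (u = 2 ∧ (v = 2 ∧ w = 1 ∨ v = -2 ∧ w = -1)) ∨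
      (u = 3 ∧ (v = 1 ∧ w = 3 ∨ v = -1 ∧ w = -3)) ∨
      (u = 6 ∧ (v = 2 ∧ w = 3 ∨ v = -2 ∧ w = -3)) := by
  rcases Int.pos_dvd_six_cases hu hu6 with rfl | rfl | rfl | rfl <;>
  rcases Int.dvd_two_cases hv2 with rfl | rfl | rfl | rfl <;>
  rcases Int.dvd_three_cases hw3 with rfl | rfl | rfl | rfl <;>
  first
  | simp; done
  | exact absurd huvw (by norm_num)

/-- Half of the classes in `square_class_cases` have no solution modulo `9`. -/
theorem square_class_local {A D a b c u v w : ℤ} (hAD : IsCoprime A D) (ea : A = u * a ^ 2)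
    (eb : A - 8 * D ^ 2 = v * b ^ 2) (ec : A - 9 * D ^ 2 = w * c ^ 2)
    (huvw : (u = 1 ∧ (v = 1 ∧ w = 1 ∨ v = -1 ∧ w = -1)) ∨
        (u = 2 ∧ (v = 2 ∧ w = 1 ∨ v = -2 ∧ w = -1)) ∨
        (u = 3 ∧ (v = 1 ∧ w = 3 ∨ v = -1 ∧ w = -3)) ∨
        (u = 6 ∧ (v = 2 ∧ w = 3 ∨ v = -2 ∧ w = -3))) :
    (A = a ^ 2 ∧ A - 8 * D ^ 2 = b ^ 2 ∧ A - 9 * D ^ 2 = c ^ 2) ∨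
      (A = 2 * a ^ 2 ∧ A - 8 * D ^ 2 = -2 * b ^ 2 ∧ A - 9 * D ^ 2 = -c ^ 2) ∨
      (A = 3 * a ^ 2 ∧ A - 8 * D ^ 2 = b ^ 2 ∧ A - 9 * D ^ 2 = 3 * c ^ 2) ∨
      (A = 6 * a ^ 2 ∧ A - 8 * D ^ 2 = -2 * b ^ 2 ∧ A - 9 * D ^ 2 = -3 * c ^ 2) := by
  have hsq (x : ℤ) : x ^ 2 % 3 = 0 ∨ x ^ 2 % 3 = 1 := (Int.sq_emod_three x).imp (·.2) (·.2)
  have hdvd {x : ℤ} (hx : x ^ 2 % 3 = 0) : 3 ∣ x :=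
    Int.prime_three.dvd_of_dvd_pow (Int.dvd_of_emod_eq_zero hx)
  have h9 {x : ℤ} (hx : x ^ 2 % 3 = 0) : x ^ 2 % 9 = 0 := by
    obtain ⟨y, rfl⟩ := hdvd hx
    rw [mul_pow, Int.mul_emod]; simp
  have hfalse (ha : a ^ 2 % 3 = 0) (hD : D ^ 2 % 3 = 0) : False :=
    hAD.not_three_dvd ⟨by rw [ea]; exact (Int.dvd_of_emod_eq_zero ha).mul_left u, hdvd hD⟩
  have a3 := hsq a
  have b3 := hsq b
  have c3 := hsq c
  have d3 := hsq D
  have a9 := @h9 a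
  have c9 := @h9 c
  rcases huvw with ⟨rfl, ⟨rfl, rfl⟩ | ⟨rfl, rfl⟩⟩ | ⟨rfl, ⟨rfl, rfl⟩ | ⟨rfl, rfl⟩⟩ |
    ⟨rfl, ⟨rfl, rfl⟩ | ⟨rfl, rfl⟩⟩ | ⟨rfl, ⟨rfl, rfl⟩ | ⟨rfl, rfl⟩⟩
  · exact .inl ⟨by linarith, by linarith, by linarith⟩
  · have h0 : a ^ 2 % 3 = 0 ∧ c ^ 2 % 3 = 0 := by omega
    exact (hfalse h0.1 (by omega)).elim
  · have h0 : a ^ 2 % 3 = 0 ∧ c ^ 2 % 3 = 0 := by omega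
    exact (hfalse h0.1 (by omega)).elim
  · exact .inr <| .inl ⟨by linarith, by linarith, by linarith⟩
  · exact .inr <| .inr <| .inl ⟨by linarith, by linarith, by linarith⟩
  · have h0 : a ^ 2 % 3 = 0 ∧ c ^ 2 % 3 = 0 := by omega
    exact (hfalse h0.1 (by omega)).elim
  · have h0 : a ^ 2 % 3 = 0 ∧ c ^ 2 % 3 = 0 := by omega
    exact (hfalse h0.1 (by omega)).elim
  · exact .inr <| .inr <| .inr ⟨by linarith, by linarith, by linarith⟩

/-- Complete 2-descent on `B² = A (A - 8 D²) (A - 9 D²)`. -/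
theorem two_descent {A B D : ℤ} (hAD : IsCoprime A D) (hB : B ≠ 0)
    (h : A * (A - 8 * D ^ 2) * (A - 9 * D ^ 2) = B ^ 2) :
    ∃ a b c : ℤ, (A = a ^ 2 ∧ A - 8 * D ^ 2 = b ^ 2 ∧ A - 9 * D ^ 2 = c ^ 2) ∨
      (A = 2 * a ^ 2 ∧ A - 8 * D ^ 2 = -2 * b ^ 2 ∧ A - 9 * D ^ 2 = -c ^ 2) ∨
      (A = 3 * a ^ 2 ∧ A - 8 * D ^ 2 = b ^ 2 ∧ A - 9 * D ^ 2 = 3 * c ^ 2) ∨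
      (A = 6 * a ^ 2 ∧ A - 8 * D ^ 2 = -2 * b ^ 2 ∧ A - 9 * D ^ 2 = -3 * c ^ 2) := by
  have hB2 : 0 < B ^ 2 := by positivity
  have hA0 : A ≠ 0 := by rintro rfl; apply hB; simpa using h.symm
  have hq0 : A - 8 * D ^ 2 ≠ 0 := by intro h0; apply hB; simpa [h0] using h.symm
  have hr0 : A - 9 * D ^ 2 ≠ 0 := by intro h0; apply hB; simpa [h0] using h.symm
  have hApos : 0 < A := by
    by_contra! hA
    have hA : A < 0 := lt_of_le_of_ne hA hA0
    have hD := sq_nonneg D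
    have := mul_neg_of_pos_of_neg (mul_pos_of_neg_of_neg hA (by linarith : A - 8 * D ^ 2 < 0))
      (by linarith : A - 9 * D ^ 2 < 0)
    linarith
  obtain ⟨u, a, hu, ha, ea⟩ := Int.exists_squarefree_mul_sq hA0
  obtain ⟨v, b, hv, hb, eb⟩ := Int.exists_squarefree_mul_sq hq0
  obtain ⟨w, c, hw, hc, ec⟩ := Int.exists_squarefree_mul_sq hr0
  have hdvd {k x y N e : ℤ} (hkx : k ∣ x) (hx : IsCoprime x D) (hky : k ∣ y)
      (he : y = x * e + N * D ^ 4) : k ∣ N := by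
    refine ((hx.of_isCoprime_of_dvd_left hkx).pow_right (n := 4)).dvd_of_dvd_mul_right ?_
    have : N * D ^ 4 = y - x * e := by linarith
    rw [this]
    exact dvd_sub hky (hkx.mul_right e)
  have hqD : IsCoprime (A - 8 * D ^ 2) D := by
    have e : A - 8 * D ^ 2 = A + -8 * D * D := by ring
    exact e ▸ hAD.add_mul_right_left (-8 * D)
  have hrD : IsCoprime (A - 9 * D ^ 2) D := by
    have e : A - 9 * D ^ 2 = A + -9 * D * D := by ring
    exact e ▸ hAD.add_mul_right_left (-9 * D)
  have hu6 : u ∣ 6 := (hu.dvd_pow_iff_dvd three_ne_zero).1 <|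
    (hdvd (Dvd.intro _ ea.symm) hAD (hu.dvd_of_mul_sq_mul_eq_sq ha
      (by rw [← ea, ← h, mul_assoc])) (N := 72) (e := A - 17 * D ^ 2) (by ring)).trans
      (by norm_num)
  have hv2 : v ∣ 2 := (hv.dvd_pow_iff_dvd three_ne_zero).1 <|
    (hdvd (Dvd.intro _ eb.symm) hqD (hv.dvd_of_mul_sq_mul_eq_sq hb
      (m := A * (A - 9 * D ^ 2)) (by rw [← eb, ← h]; ring))
      (N := -8) (e := A - D ^ 2) (by ring)).trans (by norm_num)
  have hw3 : w ∣ 3 := (hw.dvd_pow_iff_dvd two_ne_zero).1 <|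
    (hdvd (Dvd.intro _ ec.symm) hrD (hw.dvd_of_mul_sq_mul_eq_sq hc
      (m := A * (A - 8 * D ^ 2)) (by rw [← ec, ← h]; ring))
      (N := 9) (e := A + D ^ 2) (by ring)).trans (by norm_num)
  have huvw : IsSquare (u * v * w) := by
    refine Int.isSquare_of_isSquare_sq_mul (g := a * b * c) (by positivity) ⟨B, ?_⟩
    rw [← sq, ← h, eb, ec, ea]; ring
  have hupos : 0 < u := pos_of_mul_pos_left (ea ▸ hApos) (sq_nonneg a)
  exact ⟨a, b, c, square_class_local hAD ea eb ec (square_class_cases hupos hu6 hv2 hw3 huvw)⟩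

theorem exists_int_of_rat {x y : ℚ} (hy : y ≠ 0) (h : y ^ 2 = x * (x - 8) * (x - 9)) :
    ∃ A B D : ℤ, IsCoprime A D ∧ B ≠ 0 ∧ D ≠ 0 ∧ x = A / (D : ℚ) ^ 2 ∧
      A * (A - 8 * D ^ 2) * (A - 9 * D ^ 2) = B ^ 2 := by
  obtain ⟨n, d, hd, hnd, hx⟩ : ∃ n d : ℤ, 0 < d ∧ IsCoprime n d ∧ x = n / d :=
    ⟨x.num, x.den, by exact_mod_cast x.den_pos, Int.isCoprime_iff_gcd_eq_one.2 x.reduced,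
      by exact_mod_cast (Rat.num_div_den x).symm⟩
  have hd' : (d : ℚ) ≠ 0 := by exact_mod_cast hd.ne'
  have hsq : IsSquare (d * (n * (n - 8 * d) * (n - 9 * d))) := by
    rw [← Rat.isSquare_intCast_iff]
    refine ⟨y * d ^ 2, ?_⟩
    have : y * d ^ 2 * (y * d ^ 2) = y ^ 2 * d ^ 4 := by ring
    rw [this, h, hx]
    push_cast
    field_simp
  obtain ⟨C, hC⟩ := hsq
  rw [← sq] at hC
  have hcop (k : ℤ) : IsCoprime d (n - k * d) := by
    have e : n - k * d = n + -k * d := by ring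
    exact e ▸ (hnd.add_mul_right_left (-k)).symm
  obtain ⟨D, hD⟩ := Int.sq_of_isCoprime ((hnd.symm.mul_right (hcop 8)).mul_right (hcop 9)) hC
  obtain rfl : d = D ^ 2 := hD.resolve_right fun h => by nlinarith [sq_nonneg D]
  have hD0 : D ≠ 0 := by rintro rfl; simp at hd
  obtain ⟨B, hB⟩ := Int.isSquare_of_isSquare_sq_mul hD0 ⟨C, hC.trans (sq C)⟩
  refine ⟨n, B, D, hnd.of_isCoprime_of_dvd_right (Dvd.intro_left _ (sq D).symm), ?_, hD0,
    by exact_mod_cast hx, by rw [hB, sq]⟩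
  rintro rfl
  refine hy (pow_eq_zero_iff two_ne_zero |>.1 ?_)
  have hB' : (n * (n - 8 * D ^ 2) * (n - 9 * D ^ 2) : ℚ) = 0 := by exact_mod_cast hB
  have hD0' : (D : ℚ) ≠ 0 := by exact_mod_cast hD0
  rw [h, hx]
  push_cast
  field_simp
  linear_combination hB'

/-- Rational form of the complete 2-descent on `y² = x (x - 8) (x - 9)`. -/
theorem two_descent_rat {x y : ℚ} (hy : y ≠ 0) (h : y ^ 2 = x * (x - 8) * (x - 9)) :
    ∃ a b c : ℚ, (x = a ^ 2 ∧ x - 8 = b ^ 2 ∧ x - 9 = c ^ 2) ∨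
      (x = 2 * a ^ 2 ∧ x - 8 = -2 * b ^ 2 ∧ x - 9 = -c ^ 2) ∨
      (x = 3 * a ^ 2 ∧ x - 8 = b ^ 2 ∧ x - 9 = 3 * c ^ 2) ∨
      (x = 6 * a ^ 2 ∧ x - 8 = -2 * b ^ 2 ∧ x - 9 = -3 * c ^ 2) := by
  obtain ⟨A, B, D, hAD, hB, hD, rfl, hABD⟩ := exists_int_of_rat hy h
  obtain ⟨a, b, c, H⟩ := two_descent hAD hB hABD
  have hD' : (D : ℚ) ≠ 0 := by exact_mod_cast hD
  refine ⟨a / D, b / D, c / D, ?_⟩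
  qify at H
  refine H.imp ?_ (Or.imp ?_ (Or.imp ?_ ?_)) <;>
  · rintro ⟨h1, h2, h3⟩
    refine ⟨?_, ?_, ?_⟩ <;> field_simp <;> linarith

theorem eq_nine_of_squares {x a b c : ℚ} (ha : x = a ^ 2) (hb : x - 8 = b ^ 2)
    (hc : x - 9 = c ^ 2) : x = 9 := by
  have hd : (c.den : ℚ) ≠ 0 := by exact_mod_cast c.den_ne_zero
  have hcd : c * c.den = c.num := Rat.mul_den_eq_num c
  by_contra hx
  refine not_concordant c.num c.den ⟨?_, by exact_mod_cast c.den_ne_zero, ?_, ?_⟩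
  · rw [Rat.num_ne_zero]
    rintro rfl
    exact hx (by linarith)
  · rw [← Rat.isSquare_intCast_iff]
    refine ⟨b * c.den, ?_⟩
    push_cast
    rw [← hcd]
    linear_combination (hb - hc) * (c.den : ℚ) ^ 2
  · rw [← Rat.isSquare_intCast_iff]
    refine ⟨a * c.den, ?_⟩
    push_cast
    rw [← hcd]
    linear_combination (ha - hc) * (c.den : ℚ) ^ 2

/-- Translation by the point `(12, 12)` of order `4` moves this class to the trivial one. -/
theorem eq_twelve_of_class {x y a b c : ℚ} (h : y ^ 2 = x * (x - 8) * (x - 9))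
    (ha : x = 3 * a ^ 2) (hb : x - 8 = b ^ 2) (hc : x - 9 = 3 * c ^ 2) (hy : y ≠ 0) :
    x = 12 := by
  by_contra hx
  have hx' : x - 12 ≠ 0 := sub_ne_zero.2 hx
  have ha0 : a ≠ 0 := by rintro rfl; apply hy; simp_all
  have hb0 : b ≠ 0 := by rintro rfl; apply hy; simp_all
  have hc0 : c ≠ 0 := by rintro rfl; apply hy; simp_all
  obtain ⟨l, hl⟩ : ∃ l, l * (x - 12) = y - 12 := ⟨(y - 12) / (x - 12), by field_simp⟩
  have hK : l ^ 2 * (x - 12) + 24 * l = x ^ 2 - 5 * x + 12 := by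
    refine mul_left_cancel₀ hx' ?_
    linear_combination h + (y + 12 + l * (x - 12)) * hl
  have key (e : ℚ) (he : e * (e - 8) * (e - 9) = 0) :
      (x - e) * (12 - e) * (l ^ 2 + 5 - x - e) = (12 + l * (e - 12)) ^ 2 := by
    linear_combination (12 - e) * hK - he
  have h9 : l ^ 2 + 5 - x = 9 := by
    refine eq_nine_of_squares (a := (12 - 12 * l) / (6 * a)) (b := (12 - 4 * l) / (2 * b))
      (c := (12 - 3 * l) / (3 * c)) ?_ ?_ ?_ <;> field_simp
    · have := key 0 (by norm_num)
      rw [ha] at this ⊢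
      linear_combination this
    · have := key 8 (by norm_num)
      rw [hb] at this
      linear_combination this
    · have := key 9 (by norm_num)
      rw [hc] at this
      linear_combination this
  have hl4 : l = 4 := by
    have := key 9 (by norm_num)
    rw [h9] at this
    have : (12 + l * (9 - 12)) ^ 2 = 0 := by linarith
    have := pow_eq_zero_iff two_ne_zero |>.1 this
    linarith
  subst hl4
  apply hx
  linarith

theorem affine_points {x y : ℚ} (h : y ^ 2 = x * (x - 8) * (x - 9)) :
    (x, y) ∈ ({(0, 0), (8, 0), (9, 0), (12, 12), (12, -12), (6, 6), (6, -6)} :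
      Finset (ℚ × ℚ)) := by
  have hsq {z w : ℚ} (h : z ^ 2 = w ^ 2) : z = w ∨ z = -w := sq_eq_sq_iff_eq_or_eq_neg.1 h
  simp only [Finset.mem_insert, Finset.mem_singleton, Prod.mk.injEq]
  by_cases hy : y = 0
  · subst hy
    have : x = 0 ∨ x - 8 = 0 ∨ x - 9 = 0 := by simpa [or_assoc] using h.symm
    rcases this with h | h | h
    · simp [h]
    · simp [sub_eq_zero.1 h]
    · simp [sub_eq_zero.1 h]
  have hx : x ≠ 0 := by rintro rfl; apply hy; simpa using h
  have h8 : x - 8 ≠ 0 := by intro h0; apply hy; simpa [h0] using h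
  obtain ⟨a, b, c, ⟨ha, hb, hc⟩ | ⟨ha, hb, hc⟩ | ⟨ha, hb, hc⟩ | ⟨ha, hb, hc⟩⟩ :=
    two_descent_rat hy h
  · obtain rfl := eq_nine_of_squares ha hb hc
    exact absurd (by simpa using h) hy
  · have ha0 : a ≠ 0 := by rintro rfl; simp [hx] at ha
    have : 72 / x = 9 := by
      refine eq_nine_of_squares (a := 6 / a) (b := 2 * c / a) (c := 3 * b / a) ?_ ?_ ?_ <;>
      rw [ha] <;> rw [ha] at hb hc <;> field_simp <;> linarith
    rw [div_eq_iff hx] at this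
    exact absurd (by linarith) h8
  · obtain rfl := eq_twelve_of_class h ha hb hc hy
    rcases hsq (z := y) (w := 12) (by rw [h]; norm_num) with rfl | rfl <;> simp
  · have ha0 : a ≠ 0 := by rintro rfl; simp [hx] at ha
    have : 72 / x = 12 := by
      refine eq_twelve_of_class (y := 72 * y / x ^ 2) (a := 2 / a) (b := 2 * c / a)
        (c := b / a) ?_ ?_ ?_ ?_ (by positivity)
      · rw [div_pow, mul_pow, h]; field_simp; ring
      all_goals rw [ha]; rw [ha] at hb hc; field_simp; linarith
    obtain rfl : x = 6 := by rw [div_eq_iff hx] at this; linarith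
    rcases hsq (z := y) (w := 6) (by rw [h]; norm_num) with rfl | rfl <;> simp

theorem E_nonsingular_iff {x y : ℚ} :
    E.toAffine.Nonsingular x y ↔ y ^ 2 = x * (x - 8) * (x - 9) := by
  rw [← WeierstrassCurve.Affine.equation_iff_nonsingular_of_Δ_ne_zero,
    WeierstrassCurve.Affine.equation_iff]
  · simp only [E]
    constructor <;> intro h <;> linear_combination h
  · simp [E, WeierstrassCurve.Δ, WeierstrassCurve.b₂, WeierstrassCurve.b₄, WeierstrassCurve.b₆,
      WeierstrassCurve.b₈]
    norm_num

/-- The points of `E` are the point at infinity and the affine solutions. -/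
def pointEquiv : E.toAffine.Point ≃ Option {p : ℚ × ℚ // p.2 ^ 2 = p.1 * (p.1 - 8) * (p.1 - 9)} where
  toFun
    | .zero => none
    | .some x y h => some ⟨(x, y), E_nonsingular_iff.1 h⟩
  invFun
    | none => .zero
    | some p => .some p.1.1 p.1.2 (E_nonsingular_iff.2 p.2)
  left_inv := by rintro (_ | _) <;> rfl
  right_inv := by rintro (_ | _) <;> rfl

/-- `E(ℚ)` is finite of order exactly `8`; in particular `E` has
Mordell–Weil rank `0` over `ℚ`. -/
theorem stmt_4 : Finite E.toAffine.Point ∧ Nat.card E.toAffine.Point = 8 := by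
  have e : {p : ℚ × ℚ // p.2 ^ 2 = p.1 * (p.1 - 8) * (p.1 - 9)} ≃
      ({(0, 0), (8, 0), (9, 0), (12, 12), (12, -12), (6, 6), (6, -6)} : Finset (ℚ × ℚ)) :=
    Equiv.subtypeEquivRight fun p => ⟨affine_points, fun hp => by
      simp only [Finset.mem_insert, Finset.mem_singleton] at hp
      rcases hp with rfl | rfl | rfl | rfl | rfl | rfl | rfl <;> norm_num⟩
  have e' := pointEquiv.trans e.optionCongr
  refine ⟨Finite.of_equiv _ e'.symm, ?_⟩
  rw [Nat.card_congr e', Nat.card_eq_fintype_card, Fintype.card_option, Fintype.card_coe]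
  rfl
end

section
/- The integral points on the curve Y² = X³ − 17X² + 72X are exactly (X, Y) ∈ {(0,0), (8,0), (9,0), (6,6), (6,−6), (12,12), (12,−12)}; that is, for all integers x, y with y² = x³ − 17x² + 72x, the pair (x,y) is one of these seven. -/
/-- A positive factor of a square that is coprime to its cofactor is a square. -/
theorem exists_eq_sq_of_isCoprime_of_pos {a b c : ℤ} (hab : IsCoprime a b) (ha : 0 < a)
    (h : a * b = c ^ 2) : ∃ s, 0 ≤ s ∧ a = s ^ 2 := by
  obtain ⟨s, hs | hs⟩ := Int.sq_of_isCoprime hab h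
  · exact ⟨|s|, abs_nonneg s, by rw [sq_abs, hs]⟩
  · nlinarith [sq_nonneg s]

theorem three_mul_sub_one_ne_sq (n s : ℤ) : 3 * n - 1 ≠ s ^ 2 := by
  intro h
  have hmod : s ^ 2 % 3 = 2 := by omega
  have hs : s % 3 = 0 ∨ s % 3 = 1 ∨ s % 3 = 2 := by omega
  rcases hs with hs | hs | hs <;> simp [pow_two, Int.mul_emod, hs] at hmod

theorem isCoprime_two_pow_of_odd {n : ℤ} (hn : Odd n) (k : ℕ) : IsCoprime n (2 ^ k) := by
  obtain ⟨j, rfl⟩ := hn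
  exact IsCoprime.pow_right ⟨1, -j, by ring⟩

theorem exists_half_of_sq_eq_four_mul {y n : ℤ} (h : y ^ 2 = 4 * n) : ∃ z, z ^ 2 = n := by
  have hy : (2 : ℤ) ∣ y := Int.prime_two.dvd_of_dvd_pow (n := 2) ⟨2 * n, by linarith⟩
  obtain ⟨z, rfl⟩ := hy
  exact ⟨z, by linarith⟩

theorem le_twelve_of_not_three_dvd {x y : ℤ} (h : y ^ 2 = x * (x - 8) * (x - 9)) (hx : 9 < x)
    (h3 : ¬ 3 ∣ x) : x ≤ 12 := by
  have h9 : IsCoprime x ((3 : ℤ) ^ 2) :=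
    ((Int.prime_three.coprime_iff_not_dvd.mpr h3).symm).pow_right
  have h1 : IsCoprime x (x - 9) := by
    obtain ⟨a, b, hab⟩ := h9
    exact ⟨a + b, -b, by linear_combination hab⟩
  have h2 : IsCoprime (x - 8) (x - 9) := ⟨1, -1, by ring⟩
  obtain ⟨t, ht, hxt⟩ := exists_eq_sq_of_isCoprime_of_pos (h1.mul_left h2)
    (by nlinarith) h.symm
  have hlt : t < x - 4 := by nlinarith
  nlinarith [show t ≤ x - 5 by omega]

theorem le_four_of_odd {k z : ℤ} (h : z ^ 2 = k * (k - 3) * (3 * k - 8)) (hk : 3 < k)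
    (hodd : Odd k) : k ≤ 4 := by
  have h1 : IsCoprime k (3 * k - 8) := by
    obtain ⟨a, b, hab⟩ := isCoprime_two_pow_of_odd hodd 3
    exact ⟨a + 3 * b, -b, by linear_combination hab⟩
  have h2 : IsCoprime (k - 3) (3 * k - 8) := ⟨-3, 1, by ring⟩
  obtain ⟨t, ht, hkt⟩ := exists_eq_sq_of_isCoprime_of_pos (h1.mul_left h2)
    (by nlinarith) h.symm
  have hlt : 2 * t < 2 * k - 3 := by nlinarith
  nlinarith [show t ≤ k - 2 by omega]

theorem not_odd_of_sq_eq {m w : ℤ} (h : w ^ 2 = m * (2 * m - 3) * (3 * m - 4)) (hm : 1 < m) :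
    ¬ Odd m := by
  intro hodd
  have h1 : IsCoprime (3 * m - 4) m := by
    obtain ⟨a, b, hab⟩ := isCoprime_two_pow_of_odd hodd 2
    exact ⟨-b, a + 3 * b, by linear_combination hab⟩
  have h2 : IsCoprime (3 * m - 4) (2 * m - 3) := ⟨2, -3, by ring⟩
  obtain ⟨s, -, hs⟩ := exists_eq_sq_of_isCoprime_of_pos (h1.mul_right h2) (by linarith)
    (c := w) (by linear_combination -h)
  exact three_mul_sub_one_ne_sq (m - 1) s (by linarith)

theorem le_one_of_sq_eq {n w : ℤ} (h : w ^ 2 = n * (4 * n - 3) * (3 * n - 2)) (hn : 0 < n) :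
    n ≤ 1 := by
  rcases Int.even_or_odd' n with ⟨e, rfl | he⟩
  · obtain ⟨v, hv⟩ := exists_half_of_sq_eq_four_mul
      (n := e * (8 * e - 3) * (3 * e - 1)) (h.trans (by ring))
    have h1 : IsCoprime (3 * e - 1) e := ⟨-1, 3, by ring⟩
    have h2 : IsCoprime (3 * e - 1) (8 * e - 3) := ⟨8, -3, by ring⟩
    obtain ⟨s, -, hs⟩ := exists_eq_sq_of_isCoprime_of_pos (h1.mul_right h2) (by linarith)
      (c := v) (by linear_combination -hv)
    exact absurd hs (three_mul_sub_one_ne_sq e s)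
  · have h1 : IsCoprime n (3 * n - 2) := by
      obtain ⟨a, b, hab⟩ := isCoprime_two_pow_of_odd ⟨e, he⟩ 1
      exact ⟨a + 3 * b, -b, by linear_combination hab⟩
    have h2 : IsCoprime (4 * n - 3) (3 * n - 2) := ⟨-3, 4, by ring⟩
    obtain ⟨t, ht, hnt⟩ := exists_eq_sq_of_isCoprime_of_pos (h1.mul_left h2)
      (by nlinarith) h.symm
    have hlt : t < 2 * n := by nlinarith
    nlinarith [show t ≤ 2 * n - 1 by omega]

theorem le_twelve_of_sq_eq {x y : ℤ} (h : y ^ 2 = x * (x - 8) * (x - 9)) : x ≤ 12 := by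
  by_contra! hx
  by_cases h3 : (3 : ℤ) ∣ x
  · obtain ⟨k, rfl⟩ := h3
    have hy : (3 : ℤ) ∣ y := Int.prime_three.dvd_of_dvd_pow (n := 2)
      ⟨k * (3 * k - 8) * (3 * k - 9), by linarith⟩
    obtain ⟨z, rfl⟩ := hy
    have hz : z ^ 2 = k * (k - 3) * (3 * k - 8) := by linarith
    rcases Int.even_or_odd' k with ⟨m, rfl | hk⟩
    · obtain ⟨w, hw⟩ := exists_half_of_sq_eq_four_mul
        (n := m * (2 * m - 3) * (3 * m - 4)) (hz.trans (by ring))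
      rcases Int.even_or_odd' m with ⟨n, rfl | hm⟩
      · obtain ⟨v, hv⟩ := exists_half_of_sq_eq_four_mul
          (n := n * (4 * n - 3) * (3 * n - 2)) (hw.trans (by ring))
        have := le_one_of_sq_eq hv (by linarith)
        linarith
      · exact not_odd_of_sq_eq hw (by linarith) ⟨n, hm⟩
    · have := le_four_of_odd hz (by linarith) ⟨m, hk⟩
      linarith
  · exact absurd (le_twelve_of_not_three_dvd h (by linarith) h3) (by linarith)

/-- the integral points on `y² = x³ − 17x² + 72x` are exactly the seven listed. -/
theorem stmt_8 (x y : ℤ) (h : y ^ 2 = x ^ 3 - 17 * x ^ 2 + 72 * x) :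
    (x, y) = (0, 0) ∨ (x, y) = (8, 0) ∨ (x, y) = (9, 0) ∨
      (x, y) = (6, 6) ∨ (x, y) = (6, -6) ∨ (x, y) = (12, 12) ∨ (x, y) = (12, -12) := by
  have hx12 : x ≤ 12 := le_twelve_of_sq_eq (h.trans (by ring))
  have hx0 : 0 ≤ x := by
    by_contra! hx
    nlinarith [sq_nonneg y, mul_pos_of_neg_of_neg hx hx, mul_pos (neg_pos.mpr hx)
      (mul_pos_of_neg_of_neg hx hx)]
  have hy : y ^ 2 ≤ 12 ^ 2 := by
    rw [h]
    interval_cases x <;> norm_num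
  obtain ⟨hy1, hy2⟩ := abs_le.mp (abs_le_of_sq_le_sq hy (by norm_num))
  simp only [Prod.mk.injEq]
  interval_cases x <;> interval_cases y <;> omega
end

section
/- The affine rational points of the genus-one quartic 𝒞 : v² = 16y⁴ + 136y² + 1 are exactly (y, v) ∈ {(0,1), (0,−1), (1/2,6), (1/2,−6), (−1/2,6), (−1/2,−6)}; that is, for all y, v ∈ ℚ with v² = 16y⁴ + 136y² + 1, the pair (y,v) is one of these six. -/
/-- If `r² A = q² B` with `q`, `r` coprime, then `A` and `B` are proportional to `q²` and `r²`. -/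
lemma exists_eq_sq_mul_of_sq_mul_eq {q r A B : ℤ} (hqr : IsCoprime q r) (hq : q ≠ 0)
    (h : r ^ 2 * A = q ^ 2 * B) : ∃ k, A = q ^ 2 * k ∧ B = r ^ 2 * k := by
  have hd : q ^ 2 ∣ r ^ 2 * A := ⟨B, h⟩
  obtain ⟨k, rfl⟩ := (hqr.pow (m := 2) (n := 2)).dvd_of_dvd_mul_left hd
  refine ⟨k, rfl, ?_⟩
  have hq2 : q ^ 2 ≠ 0 := pow_ne_zero 2 hq
  apply mul_left_cancel₀ hq2
  linear_combination -h

/-- The four number lemma for integers. -/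
lemma exists_four_factors {a b m n : ℤ} (h : a * b = m * n) (hm : m ≠ 0) :
    ∃ p q r s, m = p * q ∧ a = p * r ∧ b = q * s ∧ n = r * s := by
  have hd : m ∣ a * b := ⟨n, h⟩
  obtain ⟨p, q, ⟨r, rfl⟩, ⟨s, rfl⟩, rfl⟩ := exists_dvd_and_dvd_of_dvd_mul hd
  refine ⟨p, q, r, s, rfl, rfl, rfl, ?_⟩
  apply mul_left_cancel₀ hm
  linear_combination -h

lemma Int.sq_emod_cases (x : ℤ) :
    (x % 2 = 1 ∧ x ^ 2 % 8 = 1) ∨ (x % 2 = 0 ∧ x ^ 2 % 4 = 0) := by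
  rcases Int.even_or_odd x with hx | hx
  · right
    obtain ⟨t, rfl⟩ := hx
    exact ⟨by omega, by rw [show (t + t) ^ 2 = 4 * t ^ 2 by ring]; omega⟩
  · left
    exact ⟨Int.odd_iff.mp hx, by have := Int.eight_dvd_sq_sub_one_of_odd hx; omega⟩

lemma IsCoprime.not_both_even {x y : ℤ} (h : IsCoprime x y) : ¬(x % 2 = 0 ∧ y % 2 = 0) := by
  rintro ⟨hx, hy⟩
  have := h.isUnit_of_dvd' (Int.dvd_of_emod_eq_zero hx) (Int.dvd_of_emod_eq_zero hy)
  exact absurd this (by decide)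

lemma dvd_of_dvd_mul_sq_of_isCoprime {p s k c : ℤ} (h : IsCoprime p s) (hp : k ∣ c * p ^ 2)
    (hs : k ∣ c * s ^ 2) : k ∣ c := by
  obtain ⟨x, y, hxy⟩ := h.pow (m := 2) (n := 2)
  have : c = x * (c * p ^ 2) + y * (c * s ^ 2) := by linear_combination -c * hxy
  rw [this]
  exact dvd_add (hp.mul_left _) (hs.mul_left _)

lemma Int.eq_of_pos_of_dvd_eight {k : ℤ} (hk : 0 < k) (h : k ∣ 8) :
    k = 1 ∨ k = 2 ∨ k = 4 ∨ k = 8 := by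
  have := Int.le_of_dvd (by norm_num) h
  interval_cases k <;> simp_all

/-- Two primitive Pythagorean triples with the same even leg cannot have odd legs in
ratio `3 : 1`. -/
lemma false_of_sq_sub_sq_eq_three_mul {a b m n : ℤ} (hab : IsCoprime a b) (hmn : IsCoprime m n)
    (hpar : Odd (a + b)) (h0 : a * b ≠ 0) (h : a * b = m * n)
    (h3 : a ^ 2 - b ^ 2 = 3 * (m ^ 2 - n ^ 2)) : False := by
  have hm : m ≠ 0 := by rintro rfl; simp [h] at h0
  obtain ⟨p, q, r, s, rfl, rfl, rfl, rfl⟩ := exists_four_factors h hm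
  have hq : q ≠ 0 := by rintro rfl; simp at h0
  have hp : p ≠ 0 := by rintro rfl; simp at h0
  have cpq : IsCoprime p q := hab.of_mul_left_left.of_mul_right_left
  have cps : IsCoprime p s := hab.of_mul_left_left.of_mul_right_right
  have crq : IsCoprime r q := hab.of_mul_left_right.of_mul_right_left
  have crs : IsCoprime r s := hab.of_mul_left_right.of_mul_right_right
  have cpr : IsCoprime p r := hmn.of_mul_left_left.of_mul_right_left
  have cqs : IsCoprime q s := hmn.of_mul_left_right.of_mul_right_right
  obtain ⟨k, hk1, hk2⟩ := exists_eq_sq_mul_of_sq_mul_eq (A := p ^ 2 + 3 * s ^ 2)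
    (B := 3 * p ^ 2 + s ^ 2) crq.symm hq (by linear_combination h3)
  have hk8 : k ∣ 8 := dvd_of_dvd_mul_sq_of_isCoprime cps
    ⟨3 * r ^ 2 - q ^ 2, by linear_combination 3 * hk2 - hk1⟩
    ⟨3 * q ^ 2 - r ^ 2, by linear_combination 3 * hk1 - hk2⟩
  have hkpos : 0 < k := by
    have : 0 < q ^ 2 * k := by rw [← hk1]; positivity
    exact pos_of_mul_pos_right this (sq_nonneg q)
  have hone : p % 2 = 0 ∨ q % 2 = 0 ∨ r % 2 = 0 ∨ s % 2 = 0 := by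
    by_contra! hc
    have hp' : Odd p := Int.odd_iff.mpr (by omega)
    have hq' : Odd q := Int.odd_iff.mpr (by omega)
    have hr' : Odd r := Int.odd_iff.mpr (by omega)
    have hs' : Odd s := Int.odd_iff.mpr (by omega)
    exact (Int.not_even_iff_odd.mpr hpar) ((hp'.mul hr').add_odd (hq'.mul hs'))
  have := cpq.not_both_even
  have := cps.not_both_even
  have := crq.not_both_even
  have := crs.not_both_even
  have := cpr.not_both_even
  have := cqs.not_both_even
  have := p.sq_emod_cases
  have := q.sq_emod_cases
  have := r.sq_emod_cases
  have := s.sq_emod_cases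
  rcases Int.eq_of_pos_of_dvd_eight hkpos hk8 with rfl | rfl | rfl | rfl <;> omega

/-- Primitive Pythagorean triples, without a sign condition on the hypotenuse. -/
lemma exists_of_sq_add_sq_eq_sq {x y z : ℤ} (h : x ^ 2 + y ^ 2 = z ^ 2) (hc : IsCoprime x y)
    (hx : x % 2 = 1) :
    ∃ m n, x = m ^ 2 - n ^ 2 ∧ y = 2 * m * n ∧ IsCoprime m n ∧ Odd (m + n) := by
  have hz : z ≠ 0 := by
    rintro rfl
    have hx0 : x ≠ 0 := by rintro rfl; simp at hx
    have : 0 < x ^ 2 + y ^ 2 := by positivity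
    simp [h] at this
  have ht : PythagoreanTriple x y |z| := by
    unfold PythagoreanTriple
    rw [abs_mul_abs_self]
    linear_combination h
  obtain ⟨m, n, h1, h2, -, h4, h5, -⟩ :=
    ht.coprime_classification' (Int.isCoprime_iff_gcd_eq_one.mp hc) hx (abs_pos.mpr hz)
  exact ⟨m, n, h1, h2, Int.isCoprime_iff_gcd_eq_one.mpr h4, Int.odd_iff.mpr (by omega)⟩

lemma isCoprime_three_of_not_dvd {x : ℤ} (h : ¬(3 : ℤ) ∣ x) : IsCoprime 3 x :=
  Int.prime_three.coprime_iff_not_dvd.mpr h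

/-- `(u, v)` is a nontrivial primitive solution of `u⁴ + 34u²v² + v⁴ = □` of opposite parity. -/
def IsQuarticSol (u v : ℤ) : Prop :=
  IsCoprime u v ∧ Odd (u + v) ∧ u * v ≠ 0 ∧ ∃ w, u ^ 4 + 34 * u ^ 2 * v ^ 2 + v ^ 4 = w ^ 2

lemma exists_isQuarticSol_of_even_left {p s q r : ℤ} (hc : IsCoprime p s) (hp : p ≠ 0)
    (hs : s % 2 = 1) (h1 : p ^ 2 + s ^ 2 = q ^ 2) (h9 : 9 * p ^ 2 + s ^ 2 = r ^ 2) :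
    ∃ u v, IsQuarticSol u v ∧ p = 2 * (u * v) := by
  obtain ⟨u, v, rfl, rfl, huv, hpar⟩ :=
    exists_of_sq_add_sq_eq_sq (z := q) (by linear_combination h1) hc.symm hs
  refine ⟨u, v, ⟨huv, hpar, ?_, r, by linear_combination h9⟩, by ring⟩
  intro h
  apply hp
  linear_combination 2 * h

lemma exists_isQuarticSol_of_even_right {p s q r : ℤ} (hc : IsCoprime p s) (hs : s ≠ 0)
    (hp : p % 2 = 1) (h1 : p ^ 2 + s ^ 2 = q ^ 2) (h9 : 9 * p ^ 2 + s ^ 2 = r ^ 2) :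
    ∃ u v, IsQuarticSol u v ∧ s = 6 * (u * v) := by
  by_cases h3 : (3 : ℤ) ∣ s
  · obtain ⟨t, rfl⟩ := h3
    have hr : (3 : ℤ) ∣ r := by
      apply Int.prime_three.dvd_of_dvd_pow (n := 2)
      exact ⟨3 * p ^ 2 + 3 * t ^ 2, by linear_combination -h9⟩
    obtain ⟨r', rfl⟩ := hr
    obtain ⟨u, v, huv, rfl⟩ := exists_isQuarticSol_of_even_left (p := t) (s := p) (q := r') (r := q)
      hc.symm.of_mul_left_right (by rintro rfl; simp at hs) hp (by linarith) (by linarith)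
    exact ⟨u, v, huv, by ring⟩
  · exfalso
    obtain ⟨u, v, hu, hu', huv, hpar⟩ := exists_of_sq_add_sq_eq_sq h1 hc hp
    obtain ⟨m, n, hm, hm', hmn, hpar'⟩ := exists_of_sq_add_sq_eq_sq (x := 3 * p) (z := r)
      (by linear_combination h9) ((isCoprime_three_of_not_dvd h3).mul_left hc) (by omega)
    refine false_of_sq_sub_sq_eq_three_mul hmn huv hpar' ?_ ?_ (by rw [← hm, ← hu])
    · intro h
      apply hs
      linear_combination hm' + 2 * h
    · linarith

lemma exists_isQuarticSol_of_pair {p s q r : ℤ} (hc : IsCoprime p s) (hps : p * s ≠ 0)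
    (hpar : Odd (p + s)) (h1 : p ^ 2 + s ^ 2 = q ^ 2) (h9 : 9 * p ^ 2 + s ^ 2 = r ^ 2) :
    ∃ u v, IsQuarticSol u v ∧ (u * v).natAbs < (p * s).natAbs := by
  have hp := left_ne_zero_of_mul hps
  have hs := right_ne_zero_of_mul hps
  have hpar' := Int.odd_iff.mp hpar
  rw [Int.natAbs_mul p s]
  have hp1 : 1 ≤ p.natAbs := by omega
  have hs1 : 1 ≤ s.natAbs := by omega
  rcases Int.emod_two_eq_zero_or_one p with h | h
  · obtain ⟨u, v, huv, e⟩ := exists_isQuarticSol_of_even_left hc hp (by omega) h1 h9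
    have : (u * v).natAbs < p.natAbs := by omega
    exact ⟨u, v, huv, by nlinarith⟩
  · obtain ⟨u, v, huv, e⟩ := exists_isQuarticSol_of_even_right hc hs h h1 h9
    have : (u * v).natAbs < s.natAbs := by omega
    exact ⟨u, v, huv, by nlinarith⟩

lemma exists_isQuarticSol_of_sq_sub_sq {a b m n : ℤ} (hab : IsCoprime a b) (hmn : IsCoprime m n)
    (hpar : Odd (a + b)) (h0 : a * b ≠ 0) (h : a * b = m * n)
    (h9 : a ^ 2 - b ^ 2 = 9 * m ^ 2 - n ^ 2) :
    ∃ u v, IsQuarticSol u v ∧ (u * v).natAbs < (a * b).natAbs := by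
  have hm : m ≠ 0 := by rintro rfl; simp [h] at h0
  obtain ⟨p, q, r, s, rfl, rfl, rfl, rfl⟩ := exists_four_factors h hm
  have hp : p ≠ 0 := by rintro rfl; simp at h0
  have hq : q ≠ 0 := by rintro rfl; simp at h0
  have hr : r ≠ 0 := by rintro rfl; simp at h0
  have hs : s ≠ 0 := by rintro rfl; simp at h0
  have cpq : IsCoprime p q := hab.of_mul_left_left.of_mul_right_left
  have cps : IsCoprime p s := hab.of_mul_left_left.of_mul_right_right
  have crq : IsCoprime r q := hab.of_mul_left_right.of_mul_right_left
  have crs : IsCoprime r s := hab.of_mul_left_right.of_mul_right_right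
  have cpr : IsCoprime p r := hmn.of_mul_left_left.of_mul_right_left
  have cqs : IsCoprime q s := hmn.of_mul_left_right.of_mul_right_right
  obtain ⟨k, hk1, hk2⟩ := exists_eq_sq_mul_of_sq_mul_eq (A := p ^ 2 + s ^ 2)
    (B := 9 * p ^ 2 + s ^ 2) crq.symm hq (by linear_combination h9)
  have hk8 : k ∣ 8 := dvd_of_dvd_mul_sq_of_isCoprime cps
    ⟨r ^ 2 - q ^ 2, by linear_combination hk2 - hk1⟩
    ⟨9 * q ^ 2 - r ^ 2, by linear_combination 9 * hk1 - hk2⟩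
  have hkpos : 0 < k := by
    have : 0 < q ^ 2 * k := by rw [← hk1]; positivity
    exact pos_of_mul_pos_right this (sq_nonneg q)
  have hone : p % 2 = 0 ∨ q % 2 = 0 ∨ r % 2 = 0 ∨ s % 2 = 0 := by
    by_contra! hc
    have hp' : Odd p := Int.odd_iff.mpr (by omega)
    have hq' : Odd q := Int.odd_iff.mpr (by omega)
    have hr' : Odd r := Int.odd_iff.mpr (by omega)
    have hs' : Odd s := Int.odd_iff.mpr (by omega)
    exact (Int.not_even_iff_odd.mpr hpar) ((hp'.mul hr').add_odd (hq'.mul hs'))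
  have := cpq.not_both_even
  have := cps.not_both_even
  have := crq.not_both_even
  have := crs.not_both_even
  have := cpr.not_both_even
  have := cqs.not_both_even
  have := p.sq_emod_cases
  have := q.sq_emod_cases
  have := r.sq_emod_cases
  have := s.sq_emod_cases
  have hk : k = 1 ∧ (p + s) % 2 = 1 := by
    rcases Int.eq_of_pos_of_dvd_eight hkpos hk8 with rfl | rfl | rfl | rfl <;> omega
  obtain ⟨rfl, hps⟩ := hk
  obtain ⟨u, v, huv, hlt⟩ := exists_isQuarticSol_of_pair cps (mul_ne_zero hp hs)
    (Int.odd_iff.mpr hps) (by linarith : p ^ 2 + s ^ 2 = q ^ 2) (by linarith : _ = r ^ 2)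
  refine ⟨u, v, huv, hlt.trans_le ?_⟩
  rw [show p * r * (q * s) = p * s * (r * q) by ring, Int.natAbs_mul (p * s)]
  exact Nat.le_mul_of_pos_right _ (Int.natAbs_pos.mpr (mul_ne_zero hr hq))

lemma IsCoprime.sq_sub_sq_mul {a b : ℤ} (h : IsCoprime a b) :
    IsCoprime (a ^ 2 - b ^ 2) (a * b) := by
  refine IsCoprime.mul_right ?_ ?_
  · have := (h.symm.pow_left (m := 2)).neg_left.add_mul_right_left a
    rwa [show -b ^ 2 + a * a = a ^ 2 - b ^ 2 by ring] at this
  · have := (h.pow_left (m := 2)).add_mul_right_left (-b)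
    rwa [show a ^ 2 + -b * b = a ^ 2 - b ^ 2 by ring] at this

lemma IsQuarticSol.exists_lt {a b : ℤ} (h : IsQuarticSol a b) :
    ∃ u v, IsQuarticSol u v ∧ (u * v).natAbs < (a * b).natAbs := by
  obtain ⟨hab, hpar, h0, c, hc⟩ := h
  have hodd : (a ^ 2 - b ^ 2) % 2 = 1 := by
    have := a.sq_emod_cases
    have := b.sq_emod_cases
    have := Int.odd_iff.mp hpar
    omega
  have hco := hab.sq_sub_sq_mul
  have hco2 : IsCoprime (a ^ 2 - b ^ 2) 2 :=
    (Int.prime_two.coprime_iff_not_dvd.mpr (by omega)).symm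
  by_cases h3 : (3 : ℤ) ∣ a ^ 2 - b ^ 2
  · exfalso
    obtain ⟨d, hd⟩ := h3
    have hc3 : (3 : ℤ) ∣ c := by
      apply Int.prime_three.dvd_of_dvd_pow (n := 2)
      exact ⟨3 * d ^ 2 + 12 * a ^ 2 * b ^ 2, by
        linear_combination -hc + (a ^ 2 - b ^ 2 + 3 * d) * hd⟩
    obtain ⟨e, rfl⟩ := hc3
    rw [hd] at hco hco2 hodd
    obtain ⟨m, n, rfl, hmn, hcop, -⟩ := exists_of_sq_add_sq_eq_sq (x := d) (y := 2 * (a * b))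
      (z := e) (by
        apply mul_left_cancel₀ (show (9 : ℤ) ≠ 0 by norm_num)
        linear_combination hc - (a ^ 2 - b ^ 2 + 3 * d) * hd)
      (hco2.of_mul_left_right.mul_right hco.of_mul_left_right) (by omega)
    exact false_of_sq_sub_sq_eq_three_mul hab hcop hpar h0 (by linarith) hd
  · have hco3 := (isCoprime_three_of_not_dvd h3).symm
    obtain ⟨m, n, hx, hy, hmn, -⟩ := exists_of_sq_add_sq_eq_sq (x := a ^ 2 - b ^ 2)
      (y := 2 * (3 * (a * b))) (z := c) (by linear_combination hc)
      (hco2.mul_right (hco3.mul_right hco)) hodd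
    have h3mn : (3 : ℤ) ∣ m * n := ⟨a * b, by linarith⟩
    rcases Int.prime_three.dvd_or_dvd h3mn with ⟨t, rfl⟩ | ⟨t, rfl⟩
    · exact exists_isQuarticSol_of_sq_sub_sq hab hmn.of_mul_left_right hpar h0 (by linarith)
        (by linear_combination hx)
    · rw [mul_comm a b]
      rw [mul_comm] at h0
      rw [add_comm] at hpar
      exact exists_isQuarticSol_of_sq_sub_sq hab.symm hmn.symm.of_mul_left_right hpar h0
        (by linarith) (by linear_combination -hx)

lemma not_isQuarticSol (a b : ℤ) : ¬IsQuarticSol a b := by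
  induction hN : (a * b).natAbs using Nat.strong_induction_on generalizing a b with
  | _ N ih =>
    intro h
    obtain ⟨u, v, huv, hlt⟩ := h.exists_lt
    exact ih _ (hN ▸ hlt) u v rfl huv

/-- Primitive integer solutions of `a⁴ + 34a²b² + b⁴ = c²` are trivial. -/
lemma trivial_of_quartic_eq_sq {a b c : ℤ} (hab : IsCoprime a b)
    (h : a ^ 4 + 34 * a ^ 2 * b ^ 2 + b ^ 4 = c ^ 2) : a * b = 0 ∨ a = b ∨ a = -b := by
  by_cases hpar : Odd (a + b)
  · left
    by_contra h0
    exact not_isQuarticSol a b ⟨hab, hpar, h0, c, h⟩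
  right
  have hs : (a + b) % 2 = 0 := Int.even_iff.mp (Int.not_odd_iff_even.mp hpar)
  have hne := hab.not_both_even
  obtain ⟨A, hA⟩ : ∃ A, A = (a + b) / 2 := ⟨_, rfl⟩
  obtain ⟨B, hB⟩ : ∃ B, B = (a - b) / 2 := ⟨_, rfl⟩
  obtain rfl : a = A + B := by omega
  obtain rfl : b = A - B := by omega
  by_contra! hne'
  have hA0 : A ≠ 0 := by rintro rfl; apply hne'.2; ring
  have hB0 : B ≠ 0 := by rintro rfl; apply hne'.1; ring
  have hAB : IsCoprime A B := by
    obtain ⟨x, y, hxy⟩ := hab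
    exact ⟨x + y, x - y, by linear_combination hxy⟩
  have hparAB : (A + B) % 2 = 1 := by omega
  have hodd : (A ^ 2 - B ^ 2) % 2 = 1 := by
    have := A.sq_emod_cases
    have := B.sq_emod_cases
    omega
  have hc2 : (2 : ℤ) ∣ c := by
    apply Int.prime_two.dvd_of_dvd_pow (n := 2)
    exact ⟨8 * A ^ 2 * B ^ 2 + 18 * (A ^ 2 - B ^ 2) ^ 2, by linear_combination -h⟩
  obtain ⟨d, rfl⟩ := hc2
  have hco2 : IsCoprime (A ^ 2 - B ^ 2) 2 :=
    (Int.prime_two.coprime_iff_not_dvd.mpr (by omega)).symm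
  obtain ⟨u, v, huv, -⟩ := exists_isQuarticSol_of_even_right (p := A ^ 2 - B ^ 2)
    (s := 2 * (A * B)) (q := A ^ 2 + B ^ 2) (r := d) (hco2.mul_right hAB.sq_sub_sq_mul)
    (by simp [hA0, hB0]) hodd (by ring) (by linarith)
  exact not_isQuarticSol u v huv

/-- the affine rational points of `v² = 16y⁴ + 136y² + 1` are exactly the six listed. -/
theorem stmt_9 (y v : ℚ) (h : v ^ 2 = 16 * y ^ 4 + 136 * y ^ 2 + 1) :
    (y, v) = (0, 1) ∨ (y, v) = (0, -1) ∨ (y, v) = (1/2, 6) ∨ (y, v) = (1/2, -6) ∨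
      (y, v) = (-1/2, 6) ∨ (y, v) = (-1/2, -6) := by
  have hden : ((2 * y).den : ℚ) ≠ 0 := by exact_mod_cast (2 * y).den_nz
  have hy : ((2 * y).num : ℚ) = 2 * y * (2 * y).den := (Rat.mul_den_eq_num _).symm
  have hcop : IsCoprime (2 * y).num ((2 * y).den : ℤ) := by
    rw [Int.isCoprime_iff_nat_coprime]
    exact (2 * y).reduced
  generalize (2 * y).num = a at *
  generalize (2 * y).den = b at *
  have hsq : IsSquare (a ^ 4 + 34 * a ^ 2 * (b : ℤ) ^ 2 + (b : ℤ) ^ 4) := by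
    rw [← Rat.isSquare_intCast_iff]
    refine ⟨v * b ^ 2, ?_⟩
    push_cast
    rw [hy]
    linear_combination -(b : ℚ) ^ 4 * h
  obtain ⟨c, hc⟩ := hsq
  have hcases : y = 0 ∨ y = 1 / 2 ∨ y = -1 / 2 := by
    rcases trivial_of_quartic_eq_sq hcop (hc.trans (sq c).symm) with h0 | h0 | h0
    · left
      have : (a : ℚ) * b = 0 := by exact_mod_cast h0
      rw [hy] at this
      simpa [hden] using this
    · right; left
      have : (a : ℚ) = b := by exact_mod_cast h0
      rw [hy] at this
      apply mul_right_cancel₀ hden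
      linear_combination this / 2
    · right; right
      have : (a : ℚ) = -b := by exact_mod_cast h0
      rw [hy] at this
      apply mul_right_cancel₀ hden
      linear_combination this / 2
  simp only [Prod.mk.injEq]
  rcases hcases with rfl | rfl | rfl
  · have : v = 1 ∨ v = -1 := sq_eq_sq_iff_eq_or_eq_neg.mp (by linarith)
    tauto
  · have : v = 6 ∨ v = -6 := sq_eq_sq_iff_eq_or_eq_neg.mp (by linarith)
    tauto
  · have : v = 6 ∨ v = -6 := sq_eq_sq_iff_eq_or_eq_neg.mp (by linarith)
    tauto
end

section
/- If y, v ∈ ℚ satisfy v² = 16y⁴ + 136y² + 1, then y² ∈ {0, 1/4}. -/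
lemma Int.emod_two_of_isCoprime {a b : ℤ} (h : IsCoprime a b) : a % 2 = 1 ∨ b % 2 = 1 := by
  by_contra! hab
  have := h.isUnit_of_dvd' (x := 2) (by omega) (by omega)
  revert this
  decide

lemma Int.sq_emod_eight_of_odd {a : ℤ} (h : a % 2 = 1) : a ^ 2 % 8 = 1 := by
  have ha : a % 8 = 1 ∨ a % 8 = 3 ∨ a % 8 = 5 ∨ a % 8 = 7 := by omega
  rcases ha with ha | ha | ha | ha <;> simp [pow_two, Int.mul_emod, ha]

lemma Int.sq_emod_four_of_even {a : ℤ} (h : a % 2 = 0) : a ^ 2 % 4 = 0 := by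
  obtain ⟨b, rfl⟩ := Int.dvd_of_emod_eq_zero h
  ring_nf
  omega

lemma Int.not_four_dvd_sq_add_sq_of_isCoprime {a b : ℤ} (h : IsCoprime a b) :
    (a ^ 2 + b ^ 2) % 4 ≠ 0 := by
  have hab := Int.emod_two_of_isCoprime h
  rcases Int.emod_two_eq_zero_or_one a with ha | ha <;>
  rcases Int.emod_two_eq_zero_or_one b with hb | hb <;>
  first
  | have h1 := Int.sq_emod_four_of_even ha
  | have h1 := Int.sq_emod_eight_of_odd ha
  all_goals first
  | have h2 := Int.sq_emod_four_of_even hb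
  | have h2 := Int.sq_emod_eight_of_odd hb
  all_goals omega

lemma Int.three_dvd_left_of_three_dvd_sq_add_sq {a b : ℤ} (h : (a ^ 2 + b ^ 2) % 3 = 0) :
    3 ∣ a := by
  have ha : a % 3 = 0 ∨ a % 3 = 1 ∨ a % 3 = 2 := by omega
  have hb : b % 3 = 0 ∨ b % 3 = 1 ∨ b % 3 = 2 := by omega
  rcases ha with ha | ha | ha <;> rcases hb with hb | hb | hb <;>
    simp [pow_two, Int.add_emod, Int.mul_emod, ha, hb] at h
  all_goals omega

lemma Int.exists_factorization_of_mul_eq_mul {r s t u : ℤ} (h : r * s = t * u) (hr : r ≠ 0) :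
    ∃ a b c d : ℤ, r = a * b ∧ s = c * d ∧ t = a * c ∧ u = b * d := by
  obtain ⟨a, b, ⟨c, rfl⟩, ⟨d, rfl⟩, rfl⟩ := exists_dvd_and_dvd_of_dvd_mul (Dvd.intro s h)
  refine ⟨a, b, c, d, rfl, mul_left_cancel₀ hr ?_, rfl, rfl⟩
  rw [h]; ring

lemma Int.exists_eq_mul_sq_of_sq_mul_eq {a d p q : ℤ} (had : IsCoprime a d) (hd : d ≠ 0)
    (h : a ^ 2 * p = d ^ 2 * q) : ∃ k, p = k * d ^ 2 ∧ q = k * a ^ 2 := by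
  obtain ⟨k, rfl⟩ := (had.symm.pow (m := 2) (n := 2)).dvd_of_dvd_mul_left (Dvd.intro q h.symm)
  refine ⟨k, mul_comm _ _, mul_left_cancel₀ (pow_ne_zero 2 hd) ?_⟩
  rw [← h]; ring

lemma Int.eq_of_nonneg_of_dvd_eight {b c k : ℤ} (hbc : IsCoprime b c) (hk : 0 ≤ k)
    (hb : k ∣ 8 * b ^ 2) (hc : k ∣ 8 * c ^ 2) : k = 1 ∨ k = 2 ∨ k = 4 ∨ k = 8 := by
  obtain ⟨x, y, hxy⟩ := hbc.pow (m := 2) (n := 2)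
  have h8 : k ∣ 8 := by
    have h := dvd_add (hb.mul_left x) (hc.mul_left y)
    rwa [show x * (8 * b ^ 2) + y * (8 * c ^ 2) = 8 by linear_combination 8 * hxy] at h
  have := Int.le_of_dvd (by norm_num) h8
  interval_cases k <;> omega

/-- The curve `a² + d² = b²`, `9a² + d² = c²`, on which the descent takes place. -/
def PythagoreanPair (a d : ℤ) : Prop :=
  (∃ b, a ^ 2 + d ^ 2 = b ^ 2) ∧ ∃ c, 9 * a ^ 2 + d ^ 2 = c ^ 2

lemma exists_pythagoreanPair_of_three_mul {r s t u : ℤ} (hrs : IsCoprime r s)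
    (htu : IsCoprime (3 * t) u) (heven : r * s % 2 = 0) (h0 : r * s ≠ 0) (hmul : r * s = t * u)
    (h : r ^ 2 - s ^ 2 = (3 * t) ^ 2 - u ^ 2) :
    ∃ a d, IsCoprime a d ∧ PythagoreanPair a d ∧ a * d ∣ r * s := by
  obtain ⟨a, b, c, d, rfl, rfl, rfl, rfl⟩ :=
    Int.exists_factorization_of_mul_eq_mul hmul (left_ne_zero_of_mul h0)
  have had : IsCoprime a d := hrs.of_mul_left_left.of_mul_right_right
  have hbc : IsCoprime b c := hrs.of_mul_left_right.of_mul_right_left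
  have hd : d ≠ 0 := right_ne_zero_of_mul (right_ne_zero_of_mul h0)
  obtain ⟨k, hk1, hk2⟩ := Int.exists_eq_mul_sq_of_sq_mul_eq (p := 9 * c ^ 2 - b ^ 2)
    (q := b ^ 2 - c ^ 2) had hd (by linear_combination -h)
  have hpos : 0 < a ^ 2 + d ^ 2 := by positivity
  have hk : 0 ≤ k := by
    by_contra! hneg
    nlinarith [sq_nonneg c, mul_pos_of_neg_of_neg hneg (neg_neg_of_pos hpos)]
  have hbk : k ∣ 8 * b ^ 2 := ⟨9 * a ^ 2 + d ^ 2, by linear_combination 9 * hk2 + hk1⟩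
  have hck : k ∣ 8 * c ^ 2 := ⟨a ^ 2 + d ^ 2, by linear_combination hk2 + hk1⟩
  have h4 := Int.not_four_dvd_sq_add_sq_of_isCoprime had
  rcases Int.eq_of_nonneg_of_dvd_eight hbc hk hbk hck with rfl | rfl | rfl | rfl
  · omega
  · omega
  · exfalso
    have ha : a % 2 = 1 := by
      by_contra ha
      have ha := Int.sq_emod_four_of_even (a := a) (by omega)
      have hd := Int.sq_emod_eight_of_odd ((Int.emod_two_of_isCoprime had).resolve_left ‹_›)
      omega
    have hd : d % 2 = 1 := by
      by_contra hd
      have hd := Int.sq_emod_four_of_even (a := d) (by omega)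
      have ha := Int.sq_emod_eight_of_odd ha
      omega
    have ha' := Int.sq_emod_eight_of_odd ha
    have hd' := Int.sq_emod_eight_of_odd hd
    have hc : c % 2 = 1 := by
      by_contra hc
      have hc := Int.sq_emod_four_of_even (a := c) (by omega)
      omega
    have hb : b % 2 = 1 := by
      by_contra hb
      have hb := Int.sq_emod_four_of_even (a := b) (by omega)
      have hc := Int.sq_emod_eight_of_odd hc
      omega
    simp [Int.mul_emod, ha, hb, hc, hd] at heven
  · exact ⟨a, d, had, ⟨⟨c, by linarith⟩, ⟨b, by linarith⟩⟩, ⟨b * c, by ring⟩⟩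

lemma exists_pythagoreanPair_of_eq_three_mul {r s t u : ℤ} (hrs : IsCoprime r s)
    (htu : IsCoprime t u) (heven : r * s % 2 = 0) (h0 : r * s ≠ 0) (hmul : t * u = 3 * (r * s))
    (h : r ^ 2 - s ^ 2 = t ^ 2 - u ^ 2) :
    ∃ a d, IsCoprime a d ∧ PythagoreanPair a d ∧ a * d ∣ r * s := by
  rcases Int.prime_three.dvd_or_dvd (Dvd.intro _ hmul.symm) with ⟨t, rfl⟩ | ⟨u, rfl⟩
  · exact exists_pythagoreanPair_of_three_mul hrs htu heven h0 (by linarith) h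
  · rw [mul_comm r s] at *
    exact exists_pythagoreanPair_of_three_mul hrs.symm htu.symm heven h0 (by linarith)
      (by linarith)

lemma sq_sub_sq_ne_three_mul_of_mul_eq_mul {r s t u : ℤ} (hrs : IsCoprime r s)
    (heven : r * s % 2 = 0) (h0 : r * s ≠ 0) (hmul : r * s = t * u) :
    r ^ 2 - s ^ 2 ≠ 3 * (t ^ 2 - u ^ 2) := by
  intro h
  obtain ⟨a, b, c, d, rfl, rfl, rfl, rfl⟩ :=
    Int.exists_factorization_of_mul_eq_mul hmul (left_ne_zero_of_mul h0)
  have had : IsCoprime a d := hrs.of_mul_left_left.of_mul_right_right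
  have hbc : IsCoprime b c := hrs.of_mul_left_right.of_mul_right_left
  have hd : d ≠ 0 := right_ne_zero_of_mul (right_ne_zero_of_mul h0)
  obtain ⟨k, hk1, hk2⟩ := Int.exists_eq_mul_sq_of_sq_mul_eq (p := 3 * c ^ 2 - b ^ 2)
    (q := 3 * b ^ 2 - c ^ 2) had hd (by linear_combination -h)
  have hpos : 0 < a ^ 2 + d ^ 2 := by positivity
  have hk : 0 ≤ k := by
    by_contra! hneg
    nlinarith [sq_nonneg c, sq_nonneg b, mul_pos_of_neg_of_neg hneg (neg_neg_of_pos hpos)]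
  have hbk : k ∣ 8 * b ^ 2 := ⟨3 * a ^ 2 + d ^ 2, by linear_combination 3 * hk2 + hk1⟩
  have hck : k ∣ 8 * c ^ 2 := ⟨a ^ 2 + 3 * d ^ 2, by linear_combination hk2 + 3 * hk1⟩
  have h3 : ¬ (3 ∣ b ∧ 3 ∣ c) := fun ⟨hb, hc⟩ ↦ Int.prime_three.not_isUnit (hbc.isUnit_of_dvd' hb hc)
  have hodd : b ^ 2 % 2 = c ^ 2 % 2 → b % 2 = 1 ∧ c % 2 = 1 := by
    intro hsq
    have := Int.emod_two_of_isCoprime hbc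
    rcases Int.emod_two_eq_zero_or_one b with hb | hb <;>
    rcases Int.emod_two_eq_zero_or_one c with hc | hc <;>
      simp [pow_two, Int.mul_emod, hb, hc] at hsq <;> omega
  rcases Int.eq_of_nonneg_of_dvd_eight hbc hk hbk hck with rfl | rfl | rfl | rfl
  · exact h3 ⟨Int.three_dvd_left_of_three_dvd_sq_add_sq (b := d) (by omega),
      Int.three_dvd_left_of_three_dvd_sq_add_sq (b := a) (by omega)⟩
  · obtain ⟨hb, hc⟩ := hodd (by omega)
    have hb' := Int.sq_emod_eight_of_odd hb
    have hc' := Int.sq_emod_eight_of_odd hc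
    have ha : a % 2 = 1 := by
      by_contra ha
      have ha := Int.sq_emod_four_of_even (a := a) (by omega)
      omega
    have hd : d % 2 = 1 := by
      by_contra hd
      have hd := Int.sq_emod_four_of_even (a := d) (by omega)
      omega
    simp [Int.mul_emod, ha, hb, hc, hd] at heven
  · exact h3 ⟨Int.three_dvd_left_of_three_dvd_sq_add_sq (b := d) (by omega),
      Int.three_dvd_left_of_three_dvd_sq_add_sq (b := a) (by omega)⟩
  · obtain ⟨hb, hc⟩ := hodd (by omega)
    have hb' := Int.sq_emod_eight_of_odd hb
    have hc' := Int.sq_emod_eight_of_odd hc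
    omega

/-- A Pythagorean parametrization with the parity of the legs prescribed. -/
lemma exists_param_of_sq_add_sq {x y z : ℤ} (h : x ^ 2 + y ^ 2 = z ^ 2) (hxy : IsCoprime x y)
    (hx : x % 2 = 0) :
    ∃ m n : ℤ, x = 2 * m * n ∧ y = m ^ 2 - n ^ 2 ∧ IsCoprime m n ∧ m * n % 2 = 0 := by
  have hp : PythagoreanTriple x y z := by unfold PythagoreanTriple; linarith
  obtain ⟨m, n, hmn, -, hco, hpar⟩ := PythagoreanTriple.coprime_classification.mp
    ⟨hp, Int.isCoprime_iff_gcd_eq_one.mp hxy⟩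
  have heven : m * n % 2 = 0 := by
    rcases hpar with ⟨h1, h2⟩ | ⟨h1, h2⟩ <;> simp [Int.mul_emod, h1, h2]
  rcases hmn with ⟨hx', -⟩ | ⟨hx', hy'⟩
  · rcases hpar with ⟨h1, h2⟩ | ⟨h1, h2⟩ <;>
      simp [hx', pow_two, Int.sub_emod, Int.mul_emod, h1, h2] at hx
  · exact ⟨m, n, hx', hy', Int.isCoprime_iff_gcd_eq_one.mpr hco, heven⟩

lemma natAbs_lt_of_dvd_half {a d x r s : ℤ} (hd : a * d ∣ r * s) (h0 : 2 * r * s * x ≠ 0) :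
    (a * d).natAbs < (2 * r * s * x).natAbs ∧ a * d ≠ 0 := by
  have hrs : r * s ≠ 0 := fun h ↦ h0 (by linear_combination 2 * x * h)
  have hx : x ≠ 0 := right_ne_zero_of_mul h0
  refine ⟨?_, ne_zero_of_dvd_ne_zero hrs hd⟩
  have h1 := Nat.le_of_dvd (Int.natAbs_pos.mpr hrs) (Int.natAbs_dvd_natAbs.mpr hd)
  have h2 : (2 * r * s * x).natAbs = 2 * (r * s).natAbs * x.natAbs := by
    rw [mul_assoc 2 r s, Int.natAbs_mul, Int.natAbs_mul 2]; rfl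
  have h3 := Int.natAbs_pos.mpr hrs
  have h4 := Int.natAbs_pos.mpr hx
  rw [h2]
  nlinarith

lemma PythagoreanPair.exists_smaller {a d : ℤ} (had : IsCoprime a d) (h0 : a * d ≠ 0)
    (h : PythagoreanPair a d) :
    ∃ a' d', IsCoprime a' d' ∧ PythagoreanPair a' d' ∧
      (a' * d').natAbs < (a * d).natAbs ∧ a' * d' ≠ 0 := by
  obtain ⟨⟨b, hb⟩, c, hc⟩ := h
  have hac : (3 * a) ^ 2 + d ^ 2 = c ^ 2 := by linarith
  have hpar : a % 2 = 0 ∨ d % 2 = 0 := by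
    by_contra! hne
    have h1 := Int.sq_emod_eight_of_odd (a := a) (by omega)
    have h2 := Int.sq_emod_eight_of_odd (a := d) (by omega)
    rcases Int.emod_two_eq_zero_or_one b with h | h
    · have := Int.sq_emod_four_of_even h
      omega
    · have := Int.sq_emod_eight_of_odd h
      omega
  by_cases h3 : 3 ∣ d
  · obtain ⟨e, rfl⟩ := h3
    have hae : IsCoprime a e := had.of_mul_right_right
    obtain ⟨f, rfl⟩ : 3 ∣ c := Int.prime_three.dvd_of_dvd_pow
      (Dvd.intro (3 * a ^ 2 + 3 * e ^ 2) (by linarith) : 3 ∣ c ^ 2)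
    have hf : a ^ 2 + e ^ 2 = f ^ 2 := by linarith
    rcases hpar with ha | hd
    · obtain ⟨r, s, hr, hr', hrs, hev⟩ := exists_param_of_sq_add_sq hb had ha
      obtain ⟨t, u, ht, ht', htu, hev'⟩ := exists_param_of_sq_add_sq hf hae ha
      have hmul : t * u = r * s := by linarith
      refine absurd (show r ^ 2 - s ^ 2 = 3 * (t ^ 2 - u ^ 2) by linarith)
        (sq_sub_sq_ne_three_mul_of_mul_eq_mul hrs hev ?_ hmul.symm)
      intro hz
      exact h0 (by rw [hr]; linear_combination 6 * e * hz)
    · obtain ⟨r, s, hr, hr', hrs, hev⟩ := exists_param_of_sq_add_sq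
        (by linarith [hb] : (3 * e) ^ 2 + a ^ 2 = b ^ 2) had.symm hd
      obtain ⟨t, u, ht, ht', htu, hev'⟩ := exists_param_of_sq_add_sq
        (by linarith : e ^ 2 + a ^ 2 = f ^ 2) hae.symm (by omega)
      have h0' : 2 * t * u * (3 * a) ≠ 0 := by
        rw [← ht]; intro hz; exact h0 (by linear_combination hz)
      obtain ⟨a', d', hco, hp, hdvd⟩ := exists_pythagoreanPair_of_eq_three_mul htu hrs hev'
        (fun hz ↦ h0' (by linear_combination 6 * a * hz)) (by linarith) (by linarith)
      refine ⟨a', d', hco, hp, ?_⟩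
      rw [show a * (3 * e) = 2 * t * u * (3 * a) by rw [← ht]; ring]
      exact natAbs_lt_of_dvd_half hdvd h0'
  · have hcd : IsCoprime (3 * a) d :=
      ((Int.prime_three.coprime_iff_not_dvd).mpr h3).mul_left had
    rcases hpar with ha | hd
    · obtain ⟨r, s, hr, hr', hrs, hev⟩ := exists_param_of_sq_add_sq hb had ha
      obtain ⟨t, u, ht, ht', htu, hev'⟩ := exists_param_of_sq_add_sq hac hcd (by omega)
      have h0' : 2 * r * s * d ≠ 0 := by rwa [← hr]
      obtain ⟨a', d', hco, hp, hdvd⟩ := exists_pythagoreanPair_of_eq_three_mul hrs htu hev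
        (fun hz ↦ h0' (by linear_combination 2 * d * hz)) (by linarith) (by linarith)
      refine ⟨a', d', hco, hp, ?_⟩
      rw [show a * d = 2 * r * s * d by rw [← hr]]
      exact natAbs_lt_of_dvd_half hdvd h0'
    · obtain ⟨r, s, hr, hr', hrs, hev⟩ := exists_param_of_sq_add_sq
        (by linarith : d ^ 2 + a ^ 2 = b ^ 2) had.symm hd
      obtain ⟨t, u, ht, ht', htu, hev'⟩ := exists_param_of_sq_add_sq
        (by linarith : d ^ 2 + (3 * a) ^ 2 = c ^ 2) hcd.symm hd
      refine absurd (show t ^ 2 - u ^ 2 = 3 * (r ^ 2 - s ^ 2) by linarith)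
        (sq_sub_sq_ne_three_mul_of_mul_eq_mul htu hev' ?_ (by linarith))
      intro hz
      exact h0 (by rw [ht]; linear_combination 2 * a * hz)

lemma PythagoreanPair.mul_eq_zero_of_isCoprime {a d : ℤ} (had : IsCoprime a d)
    (h : PythagoreanPair a d) : a * d = 0 := by
  induction hn : (a * d).natAbs using Nat.strong_induction_on generalizing a d with
  | _ n ih =>
    by_contra h0
    obtain ⟨a', d', hco, hp, hlt, hne⟩ := h.exists_smaller had h0
    exact hne (ih _ (hn ▸ hlt) hco hp rfl)

/-- Over `ℚ`, one may normalize `d = 1` and clear the denominator of the ratio. -/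
lemma eq_zero_of_sq_add_one_eq_sq {x b c : ℚ} (hb : x ^ 2 + 1 = b ^ 2)
    (hc : 9 * x ^ 2 + 1 = c ^ 2) : x = 0 := by
  have hden : (x.den : ℚ) ≠ 0 := by exact_mod_cast x.den_nz
  have hx : x * x.den = x.num := Rat.mul_den_eq_num x
  have isSquare_of_rat {n : ℤ} {q : ℚ} (hq : (n : ℚ) = q ^ 2) : ∃ m : ℤ, n = m ^ 2 := by
    obtain ⟨m, hm⟩ := Rat.isSquare_intCast_iff.mp ⟨q, by rw [hq, pow_two]⟩
    exact ⟨m, by rw [hm, pow_two]⟩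
  have hpair : PythagoreanPair x.num x.den := by
    refine ⟨isSquare_of_rat (q := b * x.den) ?_, isSquare_of_rat (q := c * x.den) ?_⟩
    · push_cast
      rw [← hx, mul_pow, mul_pow, ← hb]; ring
    · push_cast
      rw [← hx, mul_pow, mul_pow, ← hc]; ring
  have hzero := hpair.mul_eq_zero_of_isCoprime x.isCoprime_num_den
  rcases mul_eq_zero.mp hzero with h | h
  · exact Rat.num_eq_zero.mp h
  · exact absurd (by exact_mod_cast h) x.den_nz

/-- rational points on `v² = 16y⁴ + 136y² + 1` have `y² ∈ {0, 1/4}`. -/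
theorem stmt_10 (y v : ℚ) (h : v ^ 2 = 16 * y ^ 4 + 136 * y ^ 2 + 1) :
    y ^ 2 = 0 ∨ y ^ 2 = 1 / 4 := by
  by_cases hd : 4 * y ^ 2 - 1 = 0
  · right; linarith
  · left
    have hx : 4 * y / (4 * y ^ 2 - 1) = 0 := by
      refine eq_zero_of_sq_add_one_eq_sq (b := (4 * y ^ 2 + 1) / (4 * y ^ 2 - 1))
        (c := v / (4 * y ^ 2 - 1)) ?_ ?_
      · field_simp; ring
      · field_simp; rw [h]; ring
    have hy : y = 0 := by simpa [hd] using hx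
    simp [hy]
end

section
/- For coprime positive integers a ≠ u, with Δ := u² − a² and A₀ := a²u², the element Δ_S := (17 − 12√2)Δ² + 4A₀ of K = ℚ(√2) is not a square in K. -/
open Polynomial IntermediateField

theorem mem_K_exists_rat (x : ℝ) (hx : x ∈ K) : ∃ p q : ℚ, x = p + q * Real.sqrt 2 := by
  have h2 : Real.sqrt 2 * Real.sqrt 2 = 2 := Real.mul_self_sqrt (by norm_num)
  unfold K at hx
  have hint : IsIntegral ℚ (Real.sqrt 2) := by
    refine ⟨X ^ 2 - C 2, monic_X_pow_sub_C 2 (by norm_num), ?_⟩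
    simp
  rw [← IntermediateField.mem_toSubalgebra,
    IntermediateField.adjoin_simple_toSubalgebra_of_isAlgebraic hint.isAlgebraic] at hx
  induction hx using Algebra.adjoin_induction with
  | mem y hy =>
    rw [Set.mem_singleton_iff] at hy
    exact ⟨0, 1, by simp [hy]⟩
  | algebraMap r => exact ⟨r, 0, by simp⟩
  | add y z _ _ hy hz =>
    obtain ⟨p, q, rfl⟩ := hy
    obtain ⟨r, s, rfl⟩ := hz
    exact ⟨p + r, q + s, by push_cast; ring⟩
  | mul y z _ _ hy hz =>
    obtain ⟨p, q, rfl⟩ := hy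
    obtain ⟨r, s, rfl⟩ := hz
    exact ⟨p * r + 2 * q * s, p * s + q * r, by
      push_cast; linear_combination (q : ℝ) * s * h2⟩

theorem rat_add_mul_sqrt_two_eq_zero {p q : ℚ} (h : (p : ℝ) + q * Real.sqrt 2 = 0) :
    p = 0 ∧ q = 0 := by
  have hq : q = 0 := by
    by_contra hq
    refine irrational_sqrt_two ⟨-p / q, ?_⟩
    have hq' : (q : ℝ) ≠ 0 := by exact_mod_cast hq
    push_cast
    field_simp
    linarith
  subst hq
  simpa using h

theorem rat_sq_ne_two (r : ℚ) : r ^ 2 ≠ 2 := by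
  intro h
  have h2 : ((r ^ 2 : ℚ) : ℝ) = 2 := by rw [h]; norm_num
  push_cast at h2
  refine irrational_sqrt_two ⟨|r|, ?_⟩
  rw [← h2, Real.sqrt_sq_eq_abs, Rat.cast_abs]

/-- The rational form of Fermat's theorem on `a ^ 4 + b ^ 4 = c ^ 2`, with `b = 2`. -/
theorem rat_pow_four_add_sixteen_ne_sq {t w : ℚ} (ht : t ≠ 0) : t ^ 4 + 16 ≠ w ^ 2 := by
  intro h
  refine not_fermat_42 (a := t.num * w.den) (b := 2 * t.den * w.den)
    (c := w.num * w.den * t.den ^ 2) ?_ ?_ ?_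
  · exact mul_ne_zero (Rat.num_ne_zero.mpr ht) (by exact_mod_cast w.den_nz)
  · exact mul_ne_zero (mul_ne_zero two_ne_zero (by exact_mod_cast t.den_nz))
      (by exact_mod_cast w.den_nz)
  · have e1 : (t.num : ℚ) = t * t.den := (Rat.mul_den_eq_num t).symm
    have e2 : (w.num : ℚ) = w * w.den := (Rat.mul_den_eq_num w).symm
    have : ((t.num * w.den : ℚ)) ^ 4 + (2 * t.den * w.den) ^ 4
        = (w.num * w.den * t.den ^ 2) ^ 2 := by
      rw [e1, e2]
      linear_combination ((t.den : ℚ) * w.den) ^ 4 * h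
    exact_mod_cast this

/-- The number `2` is not congruent: `2 * y ^ 2 = e ^ 3 - e` has only the trivial solutions. -/
theorem eq_of_two_mul_sq_eq_cube_sub {e y : ℚ} (h : 2 * y ^ 2 = e ^ 3 - e) :
    e = 0 ∨ e = 1 ∨ e = -1 := by
  by_cases he : e = 0
  · exact Or.inl he
  right
  have hy : y = 0 := by
    by_contra hy
    refine rat_pow_four_add_sixteen_ne_sq (t := 2 * y / e) (w := 2 * (e + 1 / e)) (by positivity) ?_
    have h1 : (2 * y / e) ^ 2 = 2 * (e - 1 / e) := by
      field_simp
      linear_combination h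
    calc (2 * y / e) ^ 4 + 16 = ((2 * y / e) ^ 2) ^ 2 + 16 := by ring
      _ = (2 * (e + 1 / e)) ^ 2 := by
        rw [h1]
        field_simp
        ring
  subst hy
  have : (e - 1) * (e + 1) = 0 := by
    apply mul_left_cancel₀ he
    linear_combination -h
  rcases mul_eq_zero.mp this with h | h
  · exact Or.inl (by linarith)
  · exact Or.inr (by linarith)

/-- There is no `x = A + B √2` with `B ≠ 0` such that `x = c ^ 2`, `x - 1 = d ^ 2` and
`x + 1 = f ^ 2` are all squares in `ℚ(√2)`. If there were, the line through `(x, cdf)` and the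
negated conjugate point would meet `y ^ 2 = x ^ 3 - x` in a rational point of its twist by `2`. -/
theorem no_three_squares {A B c₁ c₂ d₁ d₂ f₁ f₂ : ℚ} (hB : B ≠ 0)
    (hc : c₁ ^ 2 + 2 * c₂ ^ 2 = A) (hc' : 2 * c₁ * c₂ = B)
    (hd : d₁ ^ 2 + 2 * d₂ ^ 2 = A - 1) (hd' : 2 * d₁ * d₂ = B)
    (hf : f₁ ^ 2 + 2 * f₂ ^ 2 = A + 1) (hf' : 2 * f₁ * f₂ = B) : False := by
  have n1 : A ^ 2 - 2 * B ^ 2 = (c₁ ^ 2 - 2 * c₂ ^ 2) ^ 2 := by rw [← hc, ← hc']; ring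
  have n2 : (A - 1) ^ 2 - 2 * B ^ 2 = (d₁ ^ 2 - 2 * d₂ ^ 2) ^ 2 := by rw [← hd, ← hd']; ring
  have n3 : (A + 1) ^ 2 - 2 * B ^ 2 = (f₁ ^ 2 - 2 * f₂ ^ 2) ^ 2 := by rw [← hf, ← hf']; ring
  obtain ⟨g₁, hg₁⟩ : ∃ g, g = c₁ * d₁ + 2 * c₂ * d₂ := ⟨_, rfl⟩
  obtain ⟨g₂, hg₂⟩ : ∃ g, g = c₁ * d₂ + c₂ * d₁ := ⟨_, rfl⟩
  have hg : g₁ ^ 2 + 2 * g₂ ^ 2 = A * (A - 1) + 2 * B * B := by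
    rw [← hd]; nth_rw 1 [← hd']; rw [← hc, ← hc', hg₁, hg₂]; ring
  have hg' : 2 * g₁ * g₂ = A * B + B * (A - 1) := by
    rw [← hd]; nth_rw 1 [← hd']; rw [← hc, ← hc', hg₁, hg₂]; ring
  obtain ⟨y₁, hy₁⟩ : ∃ y, y = g₁ * f₁ + 2 * g₂ * f₂ := ⟨_, rfl⟩
  obtain ⟨y₂, hy₂⟩ : ∃ y, y = g₁ * f₂ + g₂ * f₁ := ⟨_, rfl⟩
  have hy : y₁ ^ 2 + 2 * y₂ ^ 2 = A ^ 3 + 6 * A * B ^ 2 - A := by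
    have : y₁ ^ 2 + 2 * y₂ ^ 2 = (g₁ ^ 2 + 2 * g₂ ^ 2) * (f₁ ^ 2 + 2 * f₂ ^ 2)
        + 2 * (2 * g₁ * g₂) * (2 * f₁ * f₂) := by rw [hy₁, hy₂]; ring
    rw [this, hg, hg', hf, hf']; ring
  have hy' : 2 * y₁ * y₂ = 3 * A ^ 2 * B + 2 * B ^ 3 - B := by
    have : 2 * y₁ * y₂ = (g₁ ^ 2 + 2 * g₂ ^ 2) * (2 * f₁ * f₂)
        + (2 * g₁ * g₂) * (f₁ ^ 2 + 2 * f₂ ^ 2) := by rw [hy₁, hy₂]; ring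
    rw [this, hg, hg', hf, hf']; ring
  obtain ⟨l, hl⟩ : ∃ l, l = y₁ / (2 * B) := ⟨_, rfl⟩
  obtain ⟨k, hk⟩ : ∃ k, k = y₂ - l * A := ⟨_, rfl⟩
  have e1 : y₁ = 2 * B * l := by rw [hl]; field_simp
  have e2 : y₂ = k + l * A := by rw [hk]; ring
  rw [e1, e2] at hy hy'
  have r1 : 4 * l * (k + l * A) = 3 * A ^ 2 + 2 * B ^ 2 - 1 := by
    apply mul_left_cancel₀ hB
    linear_combination hy'
  have r2 : 2 * k ^ 2 = (A ^ 2 - 2 * B ^ 2) * (2 * l ^ 2 - 2 * A) := by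
    linear_combination hy - A * r1
  rcases eq_of_two_mul_sq_eq_cube_sub (e := 2 * l ^ 2 - 2 * A) (y := l * (2 * l ^ 2 - 2 * A) + k)
    (by linear_combination r2 + (2 * l ^ 2 - 2 * A) * r1) with he | he | he
  · have hk0 : k = 0 := by
      rw [he] at r2
      simpa using r2
    subst hk0
    nlinarith [sq_nonneg (c₁ ^ 2 - 2 * c₂ ^ 2)]
  · have hk0 : k = -l := by
      have : (k + l) ^ 2 = 0 := by
        linear_combination (r2 + r1) / 2 + (A ^ 2 - 2 * B ^ 2 + 1 - 2 * A) / 2 * he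
      linarith [pow_eq_zero_iff (two_ne_zero) |>.mp this]
    subst hk0
    refine rat_sq_ne_two _ (n2.symm.trans ?_)
    linear_combination -r2 + (1 - (A ^ 2 - 2 * B ^ 2)) * he
  · have hk0 : k = l := by
      have : (k - l) ^ 2 = 0 := by
        linear_combination (r2 - r1) / 2 + (A ^ 2 - 2 * B ^ 2 + 1 + 2 * A) / 2 * he
      linarith [pow_eq_zero_iff (two_ne_zero) |>.mp this]
    subst hk0
    refine rat_sq_ne_two _ (n3.symm.trans ?_)
    linear_combination r2 + (A ^ 2 - 2 * B ^ 2 - 1) * he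

theorem no_rat_solution {m n p q : ℚ} (hm : m ≠ 0) (hn : n ^ 2 = m ^ 2 + 1)
    (h₁ : p ^ 2 + 2 * q ^ 2 = 17 + m ^ 2) (h₂ : p * q = -6) : False := by
  have hm1 : m ^ 2 ≠ 1 := fun h => rat_sq_ne_two n (by rw [hn, h]; norm_num)
  have hB : (m ^ 4 - 1) / (2 * m ^ 2) ≠ 0 := by
    refine div_ne_zero (fun h => hm1 ?_) (by positivity)
    have : (m ^ 2 - 1) * (m ^ 2 + 1) = 0 := by linear_combination h
    rcases mul_eq_zero.mp this with h | h
    · linarith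
    · nlinarith [sq_nonneg m]
  refine no_three_squares (A := (3 * m ^ 4 + 2 * m ^ 2 + 3) / (4 * m ^ 2))
    (B := (m ^ 4 - 1) / (2 * m ^ 2)) (c₁ := (m - 1 / m) / 2) (c₂ := (m + 1 / m) / 2)
    (d₁ := (m + 1 / m) / 2) (d₂ := (m - 1 / m) / 2)
    (f₁ := n / (2 * m) * (p + 2 * q)) (f₂ := n / (2 * m) * (p + q)) hB ?_ ?_ ?_ ?_ ?_ ?_
  · field_simp; ring
  · field_simp; ring
  · field_simp; ring
  · field_simp; ring
  · have : (n / (2 * m) * (p + 2 * q)) ^ 2 + 2 * (n / (2 * m) * (p + q)) ^ 2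
        = n ^ 2 * (3 * (p ^ 2 + 2 * q ^ 2) + 8 * (p * q)) / (4 * m ^ 2) := by field_simp; ring
    rw [this, h₁, h₂, hn]; field_simp; ring
  · have : 2 * (n / (2 * m) * (p + 2 * q)) * (n / (2 * m) * (p + q))
        = n ^ 2 * ((p ^ 2 + 2 * q ^ 2) + 3 * (p * q)) / (2 * m ^ 2) := by field_simp; ring
    rw [this, h₁, h₂, hn]; field_simp; ring

/-- `Δ_S = (17 − 12√2)Δ² + 4A₀` is never a square in `K = ℚ(√2)`. -/
theorem stmt_13 (a u : ℕ) (ha : 0 < a) (hu : 0 < u) (hau : a ≠ u) (hcop : Nat.Coprime a u)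
    (Δ A₀ : ℚ) (hΔ : Δ = (u : ℚ) ^ 2 - (a : ℚ) ^ 2) (hA₀ : A₀ = (a : ℚ) ^ 2 * (u : ℚ) ^ 2) :
    ¬ IsSquare (((17 : K) - 12 * sqrt2) * (Δ : K) ^ 2 + 4 * (A₀ : K)) := by
  rintro ⟨⟨w, hw⟩, h⟩
  obtain ⟨p, q, rfl⟩ := mem_K_exists_rat w hw
  have h' := congrArg (fun x : K => (x : ℝ)) h
  have h2 : Real.sqrt 2 * Real.sqrt 2 = 2 := Real.mul_self_sqrt (by norm_num)
  have h17 : ((17 : K) : ℝ) = 17 := rfl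
  have h12 : ((12 : K) : ℝ) = 12 := rfl
  have h4 : ((4 : K) : ℝ) = 4 := rfl
  have hs : ((sqrt2 : K) : ℝ) = Real.sqrt 2 := rfl
  have hc : ∀ r : ℚ, (((r : K)) : ℝ) = r := fun r => by simp
  simp only [IntermediateField.coe_add, IntermediateField.coe_mul, AddSubgroupClass.coe_sub,
    IntermediateField.coe_pow, h17, h12, h4, hs, hc] at h'
  obtain ⟨k1, k2⟩ := rat_add_mul_sqrt_two_eq_zero (p := p ^ 2 + 2 * q ^ 2 - 17 * Δ ^ 2 - 4 * A₀)
    (q := 2 * p * q + 12 * Δ ^ 2) (by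
      push_cast
      linear_combination -h' - (q : ℝ) ^ 2 * h2)
  have ha' : (a : ℚ) ≠ 0 := by exact_mod_cast ha.ne'
  have hu' : (u : ℚ) ≠ 0 := by exact_mod_cast hu.ne'
  have hΔ0 : Δ ≠ 0 := by
    intro h0
    have h1 : (a : ℚ) ^ 2 = (u : ℚ) ^ 2 := by linarith
    have h3 : a ^ 2 = u ^ 2 := by exact_mod_cast h1
    exact hau (Nat.pow_left_injective two_ne_zero h3)
  refine no_rat_solution (m := 2 * a * u / Δ) (n := (u ^ 2 + a ^ 2) / Δ) (p := p / Δ) (q := q / Δ)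
    (by positivity) ?_ ?_ ?_
  · field_simp
    rw [hΔ]; ring
  · field_simp
    linear_combination k1 + 4 * hA₀
  · field_simp
    linear_combination k2 / 2
end

section
/- For coprime positive integers a ≠ u, with Δ := u² − a² and A₀ := a²u², the polynomial H₋(t) = t⁴ + (3 − 2√2)Δt² − A₀ is irreducible in K[t], where K = ℚ(√2); likewise H₊(t) = t⁴ + (3 + 2√2)Δt² − A₀ is irreducible in K[t]. -/
open Polynomial IntermediateField

/-- A coprime nonzero integral solution of `X² + Y² = Z²`, `X² + 9Y² = W²` with `Z ∣ r` or
`Z ∣ t`. -/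
def ConcordantBelow (r t : ℤ) : Prop :=
  ∃ X Y Z W : ℤ, X ≠ 0 ∧ Y ≠ 0 ∧ IsCoprime X Y ∧ X ^ 2 + Y ^ 2 = Z ^ 2 ∧
    X ^ 2 + 9 * Y ^ 2 = W ^ 2 ∧ (Z ∣ r ∨ Z ∣ t)

theorem exists_eq_mul_of_mul_eq_mul {r t c d : ℤ} (hr : r ≠ 0) (h : c * d = r * t) :
    ∃ x y z w, r = x * y ∧ t = z * w ∧ c = x * z ∧ d = y * w := by
  obtain ⟨x, y, ⟨z, hz⟩, ⟨w, hw⟩, hxy⟩ := exists_dvd_and_dvd_of_dvd_mul (Dvd.intro t h.symm)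
  refine ⟨x, y, z, w, hxy, ?_, hz, hw⟩
  apply mul_left_cancel₀ hr
  rw [← h, hz, hw, hxy]
  ring

theorem exists_eq_mul_sq_of_sq_mul_eq {x w P Q : ℤ} (hw : w ≠ 0) (hxw : IsCoprime x w)
    (h : x ^ 2 * P = w ^ 2 * Q) : ∃ k, P = k * w ^ 2 ∧ Q = k * x ^ 2 := by
  obtain ⟨k, hk⟩ := (hxw.symm.pow (m := 2) (n := 2)).dvd_of_dvd_mul_left (Dvd.intro Q h.symm)
  refine ⟨k, by rw [hk]; ring, ?_⟩
  apply mul_left_cancel₀ (pow_ne_zero 2 hw)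
  rw [← h, hk]
  ring

theorem exists_sq_eq_of_even_of_mul_eq {f g k : ℤ} (hf : 0 < f) (hg : 0 < g)
    (hfg : IsCoprime f g) (h2 : 2 ∣ f) (h : f * g = 8 * k ^ 2) :
    ∃ c d, c * d = k ∧ Odd d ∧ f = 8 * c ^ 2 ∧ g = d ^ 2 := by
  have hg2 : IsCoprime 2 g := hfg.of_isCoprime_of_dvd_left h2
  have hg8 : IsCoprime (8 : ℤ) g := by
    have := hg2.pow_left (m := 3)
    norm_num at this
    exact this
  obtain ⟨f', rfl⟩ := hg8.dvd_of_dvd_mul_right (Dvd.intro (k ^ 2) h.symm)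
  have h' : f' * g = k ^ 2 := by linarith
  have hc : IsCoprime f' g := hfg.of_isCoprime_of_dvd_left (Dvd.intro_left _ rfl)
  obtain ⟨c, hc'⟩ := Int.sq_of_isCoprime hc h'
  obtain ⟨d, hd'⟩ := Int.sq_of_isCoprime hc.symm (by rw [mul_comm]; exact h')
  have hc2 : f' = c ^ 2 := by
    rcases hc' with h | h
    · exact h
    · nlinarith [sq_nonneg c]
  have hd2 : g = d ^ 2 := by
    rcases hd' with h | h
    · exact h
    · nlinarith [sq_nonneg d]
  have hd : Odd d := by
    rw [← Int.not_even_iff_odd]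
    rintro hd
    have : (2 : ℤ) ∣ g := hd2 ▸ (hd.two_dvd.trans (dvd_pow_self d two_ne_zero))
    exact absurd (hg2.isUnit_of_dvd' dvd_rfl this) (by decide)
  have hcd : (c * d) ^ 2 = k ^ 2 := by rw [← h', hc2, hd2]; ring
  rcases sq_eq_sq_iff_eq_or_eq_neg.mp hcd with h1 | h1
  · exact ⟨c, d, h1, hd, by rw [hc2], hd2⟩
  · exact ⟨-c, d, by rw [neg_mul, h1, neg_neg], hd, by rw [hc2]; ring, hd2⟩

theorem exists_sq_eq_of_mul_eq {f g k : ℤ} (hf : 0 < f) (hg : 0 < g)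
    (hfg : IsCoprime f g) (h : f * g = 8 * k ^ 2) :
    ∃ c d, c * d = k ∧ Odd d ∧ (f = 8 * c ^ 2 ∧ g = d ^ 2 ∨ g = 8 * c ^ 2 ∧ f = d ^ 2) := by
  have h2 : (2 : ℤ) ∣ f * g := ⟨4 * k ^ 2, by rw [h]; ring⟩
  rcases Int.prime_two.dvd_or_dvd h2 with h2 | h2
  · obtain ⟨c, d, h1, hd, h3⟩ := exists_sq_eq_of_even_of_mul_eq hf hg hfg h2 h
    exact ⟨c, d, h1, hd, Or.inl h3⟩
  · obtain ⟨c, d, h1, hd, h3⟩ :=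
      exists_sq_eq_of_even_of_mul_eq hg hf hfg.symm h2 (by rw [mul_comm]; exact h)
    exact ⟨c, d, h1, hd, Or.inr h3⟩

theorem Int.sq_emod_eight_of_odd_s14 {y : ℤ} (hy : Odd y) : y ^ 2 % 8 = 1 := by
  obtain ⟨m, rfl⟩ := hy
  obtain ⟨n, hn⟩ := Int.even_mul_succ_self m
  rw [show (2 * m + 1) ^ 2 = 8 * n + 1 by linear_combination 4 * hn]
  omega

theorem Int.dvd_of_dvd_mul_sq_of_dvd_mul_sq {y z k n : ℤ} (h : IsCoprime y z)
    (hy : k ∣ n * y ^ 2) (hz : k ∣ n * z ^ 2) : k ∣ n := by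
  obtain ⟨a, b, hab⟩ := h.pow (m := 2) (n := 2)
  have : n = a * (n * y ^ 2) + b * (n * z ^ 2) := by linear_combination (-n) * hab
  rw [this]
  exact dvd_add (hy.mul_left a) (hz.mul_left b)

theorem concordantBelow_of_sq_sub_eq {r t c d : ℤ} (hrt : IsCoprime r t) (hr : r ≠ 0) (ht : t ≠ 0)
    (hcd : c * d = r * t) (hd : Odd d) (h : d ^ 2 - 8 * c ^ 2 = r ^ 2 + t ^ 2) :
    ConcordantBelow r t := by
  obtain ⟨x, y, z, w, rfl, rfl, rfl, rfl⟩ := exists_eq_mul_of_mul_eq_mul hr hcd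
  obtain ⟨hx, hy⟩ := mul_ne_zero_iff.mp hr
  obtain ⟨hz, hw⟩ := mul_ne_zero_iff.mp ht
  obtain ⟨hyo, hwo⟩ := Int.odd_mul.mp hd
  have hxw : IsCoprime x w := hrt.of_mul_left_left.of_mul_right_right
  have hxz : IsCoprime x z := hrt.of_mul_left_left.of_mul_right_left
  have hyz : IsCoprime y z := hrt.of_mul_left_right.of_mul_right_left
  obtain ⟨k, hP, hQ⟩ := exists_eq_mul_sq_of_sq_mul_eq (P := y ^ 2 + 8 * z ^ 2)
    (Q := y ^ 2 - z ^ 2) hw hxw (by linear_combination -h)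
  have hk : 0 < k := by
    by_contra! hk
    nlinarith [pow_pos (abs_pos.mpr hy) 2, sq_abs y, sq_nonneg z, sq_nonneg w]
  have hk9 : k ∣ 9 := Int.dvd_of_dvd_mul_sq_of_dvd_mul_sq hyz
    ⟨w ^ 2 + 8 * x ^ 2, by linear_combination hP + 8 * hQ⟩
    ⟨w ^ 2 - x ^ 2, by linear_combination hP - hQ⟩
  have hk' := Int.le_of_dvd (by norm_num) hk9
  have hy8 := Int.sq_emod_eight_of_odd_s14 hyo
  have hw8 := Int.sq_emod_eight_of_odd_s14 hwo
  have hcases : k = 1 ∨ k = 3 ∨ k = 9 := by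
    interval_cases k <;> omega
  rcases hcases with rfl | rfl | rfl
  · exact ⟨x, z, y, w, hx, hz, hxz, by linear_combination -hQ, by linear_combination hP - hQ,
      Or.inl (Dvd.intro_left _ rfl)⟩
  · exfalso
    rcases Int.even_or_odd z with ⟨m, rfl⟩ | hzo
    · rcases Int.even_or_odd x with ⟨n, rfl⟩ | hxo
      · exact absurd (hxz.isUnit_of_dvd' (x := 2) ⟨n, by ring⟩ ⟨m, by ring⟩) (by decide)
      · have := Int.sq_emod_eight_of_odd_s14 hxo
        ring_nf at hQ
        omega
    · have := Int.sq_emod_eight_of_odd_s14 hzo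
      rcases Int.even_or_odd x with ⟨n, rfl⟩ | hxo
      · omega
      · have := Int.sq_emod_eight_of_odd_s14 hxo
        omega
  · exact ⟨z, x, w, y, hz, hx, hxz.symm, by linarith, by linarith,
      Or.inr (Dvd.intro_left _ rfl)⟩

theorem sub_sq_ne_of_coprime {r t c d : ℤ} (hrt : IsCoprime r t) (hr : r ≠ 0) (ht : t ≠ 0)
    (hcd : c * d = r * t) (hd : Odd d) : 8 * c ^ 2 - d ^ 2 ≠ r ^ 2 + t ^ 2 := by
  intro h
  obtain ⟨x, y, z, w, rfl, rfl, rfl, rfl⟩ := exists_eq_mul_of_mul_eq_mul hr hcd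
  obtain ⟨hx, hy⟩ := mul_ne_zero_iff.mp hr
  obtain ⟨hz, hw⟩ := mul_ne_zero_iff.mp ht
  obtain ⟨hyo, hwo⟩ := Int.odd_mul.mp hd
  have hxw : IsCoprime x w := hrt.of_mul_left_left.of_mul_right_right
  have hyz : IsCoprime y z := hrt.of_mul_left_right.of_mul_right_left
  obtain ⟨k, hP, hQ⟩ := exists_eq_mul_sq_of_sq_mul_eq (P := 8 * z ^ 2 - y ^ 2)
    (Q := y ^ 2 + z ^ 2) hw hxw (by linear_combination h)
  have hk : 0 < k := by
    by_contra! hk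
    nlinarith [pow_pos (abs_pos.mpr hy) 2, sq_abs y, sq_nonneg z, sq_nonneg x]
  have hk9 : k ∣ 9 := Int.dvd_of_dvd_mul_sq_of_dvd_mul_sq hyz
    ⟨8 * x ^ 2 - w ^ 2, by linear_combination 8 * hQ - hP⟩
    ⟨w ^ 2 + x ^ 2, by linear_combination hP + hQ⟩
  have hk' := Int.le_of_dvd (by norm_num) hk9
  have h3 : ¬ (3 : ℤ) ∣ k := by
    rintro ⟨j, rfl⟩
    have h3 : y ^ 2 + z ^ 2 = 3 * (j * x ^ 2) := by linear_combination hQ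
    have key : ∀ y z : ZMod 3, y ^ 2 + z ^ 2 = 0 → y = 0 ∧ z = 0 := by decide
    have h3' := congrArg (Int.cast : ℤ → ZMod 3) h3
    push_cast at h3'
    rw [show (3 : ZMod 3) = 0 from rfl, zero_mul] at h3'
    obtain ⟨h1, h2⟩ := key _ _ h3'
    exact absurd (hyz.isUnit_of_dvd' ((ZMod.intCast_zmod_eq_zero_iff_dvd y 3).mp h1)
      ((ZMod.intCast_zmod_eq_zero_iff_dvd z 3).mp h2)) (by decide)
  have hy8 := Int.sq_emod_eight_of_odd_s14 hyo
  have hw8 := Int.sq_emod_eight_of_odd_s14 hwo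
  have hk1 : k = 1 := by
    interval_cases k <;> omega
  subst hk1
  omega

theorem add_sq_ne_of_coprime {r t c d : ℤ} (hrt : IsCoprime r t) (hr : r ≠ 0) (ht : t ≠ 0)
    (hcd : c * d = r * t) (hd : Odd d) : d ^ 2 + 8 * c ^ 2 ≠ 3 * (r ^ 2 + t ^ 2) := by
  intro h
  obtain ⟨x, y, z, w, rfl, rfl, rfl, rfl⟩ := exists_eq_mul_of_mul_eq_mul hr hcd
  obtain ⟨hz, hw⟩ := mul_ne_zero_iff.mp ht
  obtain ⟨hyo, hwo⟩ := Int.odd_mul.mp hd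
  have hxw : IsCoprime x w := hrt.of_mul_left_left.of_mul_right_right
  have hyz : IsCoprime y z := hrt.of_mul_left_right.of_mul_right_left
  obtain ⟨k, hP, hQ⟩ := exists_eq_mul_sq_of_sq_mul_eq (P := 3 * y ^ 2 - 8 * z ^ 2)
    (Q := y ^ 2 - 3 * z ^ 2) hw hxw (by linear_combination -h)
  have hk1 : k ∣ 1 := Int.dvd_of_dvd_mul_sq_of_dvd_mul_sq hyz
    ⟨3 * w ^ 2 - 8 * x ^ 2, by linear_combination 3 * hP - 8 * hQ⟩
    ⟨w ^ 2 - 3 * x ^ 2, by linear_combination hP - 3 * hQ⟩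
  have hy8 := Int.sq_emod_eight_of_odd_s14 hyo
  have hw8 := Int.sq_emod_eight_of_odd_s14 hwo
  rcases Int.isUnit_iff.mp (isUnit_of_dvd_one hk1) with rfl | rfl <;> omega

theorem concordantBelow_of_add_sq_eq {r t c d : ℤ} (hrt : IsCoprime r t) (hr : r ≠ 0) (ht : t ≠ 0)
    (hcd : c * d = r * t) (hd : Odd d) (h : d ^ 2 + 8 * c ^ 2 = 9 * r ^ 2 + t ^ 2) :
    ConcordantBelow r t := by
  obtain ⟨x, y, z, w, rfl, rfl, rfl, rfl⟩ := exists_eq_mul_of_mul_eq_mul hr hcd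
  obtain ⟨hx, hy⟩ := mul_ne_zero_iff.mp hr
  obtain ⟨hz, hw⟩ := mul_ne_zero_iff.mp ht
  obtain ⟨hyo, hwo⟩ := Int.odd_mul.mp hd
  have hxw : IsCoprime x w := hrt.of_mul_left_left.of_mul_right_right
  have hxz : IsCoprime x z := hrt.of_mul_left_left.of_mul_right_left
  have hyz : IsCoprime y z := hrt.of_mul_left_right.of_mul_right_left
  obtain ⟨k, hP, hQ⟩ := exists_eq_mul_sq_of_sq_mul_eq (P := 9 * y ^ 2 - 8 * z ^ 2)
    (Q := y ^ 2 - z ^ 2) hw hxw (by linear_combination -h)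
  have hk1 : k ∣ 1 := Int.dvd_of_dvd_mul_sq_of_dvd_mul_sq hyz
    ⟨w ^ 2 - 8 * x ^ 2, by linear_combination hP - 8 * hQ⟩
    ⟨w ^ 2 - 9 * x ^ 2, by linear_combination hP - 9 * hQ⟩
  have hy8 := Int.sq_emod_eight_of_odd_s14 hyo
  have hw8 := Int.sq_emod_eight_of_odd_s14 hwo
  rcases Int.isUnit_iff.mp (isUnit_of_dvd_one hk1) with rfl | rfl
  · exact ⟨z, x, y, w, hz, hx, hxz.symm, by linear_combination -hQ,
      by linear_combination hP - 9 * hQ, Or.inl (Dvd.intro_left _ rfl)⟩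
  · omega

theorem isCoprime_sq_add_sq {r t : ℤ} (hrt : IsCoprime r t) (hodd : Odd (r ^ 2 + t ^ 2)) :
    IsCoprime (r ^ 2 + t ^ 2) (8 * (r * t) ^ 2) := by
  have h2 : IsCoprime (r ^ 2 + t ^ 2) 2 := by
    obtain ⟨m, hm⟩ := hodd
    exact ⟨1, -m, by rw [hm]; ring⟩
  have h8 : IsCoprime (r ^ 2 + t ^ 2) 8 := by
    have := h2.pow_right (n := 3)
    norm_num at this
    exact this
  have hr : IsCoprime (r ^ 2 + t ^ 2) r := by
    have := (hrt.symm.pow_left (m := 2)).add_mul_right_left r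
    rwa [show t ^ 2 + r * r = r ^ 2 + t ^ 2 by ring] at this
  have ht : IsCoprime (r ^ 2 + t ^ 2) t := by
    have := (hrt.pow_left (m := 2)).add_mul_right_left t
    rwa [show r ^ 2 + t * t = r ^ 2 + t ^ 2 by ring] at this
  exact h8.mul_right (hr.mul_right ht).pow_right

theorem concordantBelow_of_quartic_eq {r t w : ℤ} (hrt : IsCoprime r t) (hr : r ≠ 0) (ht : t ≠ 0)
    (hodd : Odd (r ^ 2 + t ^ 2)) (h : r ^ 4 + 34 * r ^ 2 * t ^ 2 + t ^ 4 = w ^ 2) :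
    ConcordantBelow r t := by
  wlog hw : 0 ≤ w generalizing w
  · exact this (w := -w) (by rw [h]; ring) (by linarith)
  have hrt0 : 0 < (r * t) ^ 2 := by positivity
  have hh : 0 < r ^ 2 + t ^ 2 := by positivity
  have hw2 : w ^ 2 = (r ^ 2 + t ^ 2) ^ 2 + 32 * (r * t) ^ 2 := by rw [← h]; ring
  have hwh : r ^ 2 + t ^ 2 < w := by nlinarith
  have hwo : Odd w := by
    have : Odd (w ^ 2) := by
      rw [hw2]
      exact hodd.pow.add_even ⟨16 * (r * t) ^ 2, by ring⟩
    exact (Int.odd_pow.mp this).resolve_right two_ne_zero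
  obtain ⟨f, hf⟩ := hwo.sub_odd hodd
  have hwf : w = r ^ 2 + t ^ 2 + 2 * f := by linarith
  have hfg : f * (f + (r ^ 2 + t ^ 2)) = 8 * (r * t) ^ 2 := by
    rw [hwf] at hw2
    linarith
  have hf0 : 0 < f := by linarith
  have hcop : IsCoprime f (f + (r ^ 2 + t ^ 2)) := by
    have := ((isCoprime_sq_add_sq hrt hodd).of_isCoprime_of_dvd_right (Dvd.intro _ hfg)).symm
    have := this.add_mul_left_right 1
    rwa [show r ^ 2 + t ^ 2 + f * 1 = f + (r ^ 2 + t ^ 2) by ring] at this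
  obtain ⟨c, d, hcd, hd, ⟨h1, h2⟩ | ⟨h1, h2⟩⟩ :=
    exists_sq_eq_of_mul_eq hf0 (by linarith) hcop hfg
  · exact concordantBelow_of_sq_sub_eq hrt hr ht hcd hd (by linarith)
  · exact absurd (by linarith) (sub_sq_ne_of_coprime hrt hr ht hcd hd)

theorem concordantBelow_of_mul_eq {r t f g : ℤ} (hrt : IsCoprime r t) (hr : r ≠ 0) (ht : t ≠ 0)
    (hf : 0 < f) (hg : 0 < g) (hfg : IsCoprime f g) (hsum : f + g = 9 * r ^ 2 + t ^ 2)
    (hmul : f * g = 8 * (r * t) ^ 2) : ConcordantBelow r t := by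
  obtain ⟨c, d, hcd, hd, ⟨h1, h2⟩ | ⟨h1, h2⟩⟩ := exists_sq_eq_of_mul_eq hf hg hfg hmul
  · exact concordantBelow_of_add_sq_eq hrt hr ht hcd hd (by linarith)
  · exact concordantBelow_of_add_sq_eq hrt hr ht hcd hd (by linarith)

theorem ConcordantBelow.symm {r t : ℤ} : ConcordantBelow r t → ConcordantBelow t r := by
  rintro ⟨X, Y, Z, W, h1, h2, h3, h4, h5, h6⟩
  exact ⟨X, Y, Z, W, h1, h2, h3, h4, h5, h6.symm⟩

theorem ConcordantBelow.mul_left {r t : ℤ} (n : ℤ) :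
    ConcordantBelow r t → ConcordantBelow (n * r) t := by
  rintro ⟨X, Y, Z, W, h1, h2, h3, h4, h5, h6⟩
  exact ⟨X, Y, Z, W, h1, h2, h3, h4, h5, h6.imp_left fun h => h.mul_left n⟩

theorem concordantBelow_of_quartic_eq' {r t w : ℤ} (hrt : IsCoprime r t) (hr : r ≠ 0) (ht : t ≠ 0)
    (hodd : Odd (r ^ 2 + t ^ 2))
    (h : 9 * r ^ 4 - 14 * r ^ 2 * t ^ 2 + 9 * t ^ 4 = w ^ 2) :
    ConcordantBelow r t := by
  wlog hw : 0 ≤ w generalizing w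
  · exact this (w := -w) (by rw [h]; ring) (by linarith)
  have hrt0 : 0 < (r * t) ^ 2 := by positivity
  have hh : 0 < r ^ 2 + t ^ 2 := by positivity
  have hw2 : w ^ 2 = 9 * (r ^ 2 + t ^ 2) ^ 2 - 32 * (r * t) ^ 2 := by rw [← h]; ring
  have hwo : Odd w := by
    have : Odd (w ^ 2) := by
      rw [hw2]
      exact (Odd.mul (by decide) hodd.pow).sub_even ⟨16 * (r * t) ^ 2, by ring⟩
    exact (Int.odd_pow.mp this).resolve_right two_ne_zero
  have h3o : Odd (3 * (r ^ 2 + t ^ 2)) := Odd.mul (by decide) hodd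
  obtain ⟨f, hf⟩ := h3o.sub_odd hwo
  obtain ⟨g, hg⟩ : ∃ g, g = f + w := ⟨_, rfl⟩
  have hsum : f + g = 3 * (r ^ 2 + t ^ 2) := by linarith
  have hfg : f * g = 8 * (r * t) ^ 2 := by
    have hw' : w = 3 * (r ^ 2 + t ^ 2) - 2 * f := by linarith
    rw [hw'] at hw2
    rw [show g = 3 * (r ^ 2 + t ^ 2) - f by linarith]
    linarith
  have hf0 : 0 < f := by nlinarith
  have hg0 : 0 < g := by linarith
  have hcopf : IsCoprime (r ^ 2 + t ^ 2) f :=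
    (isCoprime_sq_add_sq hrt hodd).of_isCoprime_of_dvd_right (Dvd.intro _ hfg)
  by_cases h3 : (3 : ℤ) ∣ f
  · obtain ⟨f', rfl⟩ := h3
    obtain ⟨g', rfl⟩ : (3 : ℤ) ∣ g := ⟨r ^ 2 + t ^ 2 - f', by linarith⟩
    have hsum' : f' + g' = r ^ 2 + t ^ 2 := by linarith
    have hcop : IsCoprime f' g' := by
      have := (hcopf.of_isCoprime_of_dvd_right (Dvd.intro_left _ rfl)).symm.add_mul_left_right (-1)
      rwa [show r ^ 2 + t ^ 2 + f' * -1 = g' by linarith] at this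
    have h3rt : (3 : ℤ) ∣ 8 * (r * t) ^ 2 := ⟨3 * f' * g', by rw [← hfg]; ring⟩
    have h3rt' : (3 : ℤ) ∣ r * t :=
      Int.prime_three.dvd_of_dvd_pow ((Int.prime_three.dvd_or_dvd h3rt).resolve_left (by decide))
    rcases Int.prime_three.dvd_or_dvd h3rt' with ⟨r', rfl⟩ | ⟨t', rfl⟩
    · exact (concordantBelow_of_mul_eq hrt.of_mul_left_right (by rintro rfl; simp at hr) ht
        (by linarith) (by linarith) hcop (by linarith) (by linarith)).mul_left 3
    · exact ((concordantBelow_of_mul_eq hrt.symm.of_mul_left_right (by rintro rfl; simp at ht) hr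
        (by linarith) (by linarith) hcop (by linarith) (by linarith)).mul_left 3).symm
  · exfalso
    have h3f : IsCoprime f 3 := (Int.prime_three.coprime_iff_not_dvd.mpr h3).symm
    have hcop : IsCoprime f g := by
      have := (h3f.mul_right hcopf.symm).add_mul_left_right (-1)
      rwa [show 3 * (r ^ 2 + t ^ 2) + f * -1 = g by linarith] at this
    obtain ⟨c, d, hcd, hd, ⟨h1, h2⟩ | ⟨h1, h2⟩⟩ := exists_sq_eq_of_mul_eq hf0 hg0 hcop hfg
    · exact add_sq_ne_of_coprime hrt hr ht hcd hd (by linarith)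
    · exact add_sq_ne_of_coprime hrt hr ht hcd hd (by linarith)

theorem concordant_descent {X Y Z W : ℤ} (hX : X ≠ 0) (hY : Y ≠ 0) (hXY : IsCoprime X Y)
    (h1 : X ^ 2 + Y ^ 2 = Z ^ 2) (h2 : X ^ 2 + 9 * Y ^ 2 = W ^ 2) :
    ∃ X' Y' Z' W' : ℤ, X' ≠ 0 ∧ Y' ≠ 0 ∧ IsCoprime X' Y' ∧ X' ^ 2 + Y' ^ 2 = Z' ^ 2 ∧
      X' ^ 2 + 9 * Y' ^ 2 = W' ^ 2 ∧ Z'.natAbs < Z.natAbs := by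
  obtain ⟨r, t, hXYrt, hZ, hgcd, hpar⟩ := PythagoreanTriple.coprime_classification.mp
    ⟨(show X * X + Y * Y = Z * Z by linarith), Int.isCoprime_iff_gcd_eq_one.mp hXY⟩
  have hrt : IsCoprime r t := Int.isCoprime_iff_gcd_eq_one.mpr hgcd
  have hodd : Odd (r ^ 2 + t ^ 2) := by
    rcases hpar with ⟨h, h'⟩ | ⟨h, h'⟩
    · exact ((Int.even_iff.mpr h).pow_of_ne_zero two_ne_zero).add_odd (Int.odd_iff.mpr h').pow
    · exact (Int.odd_iff.mpr h).pow.add_even ((Int.even_iff.mpr h').pow_of_ne_zero two_ne_zero)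
  have hrt0 : r ≠ 0 ∧ t ≠ 0 := by
    constructor <;> rintro rfl <;> rcases hXYrt with ⟨h, h'⟩ | ⟨h, h'⟩ <;> simp_all
  obtain ⟨hr, ht⟩ := hrt0
  have key : ConcordantBelow r t := by
    rcases hXYrt with ⟨rfl, rfl⟩ | ⟨rfl, rfl⟩
    · exact concordantBelow_of_quartic_eq hrt hr ht hodd (w := W) (by rw [← h2]; ring)
    · exact concordantBelow_of_quartic_eq' hrt hr ht hodd (w := W) (by rw [← h2]; ring)
  obtain ⟨X', Y', Z', W', h3, h4, h5, h6, h7, h8⟩ := key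
  refine ⟨X', Y', Z', W', h3, h4, h5, h6, h7, ?_⟩
  have hZ' : |Z| = r ^ 2 + t ^ 2 := by
    have : 0 ≤ r ^ 2 + t ^ 2 := by positivity
    rcases hZ with rfl | rfl
    · exact abs_of_nonneg this
    · rw [abs_neg, abs_of_nonneg this]
  zify
  rw [hZ']
  have hr1 := Int.one_le_abs hr
  have ht1 := Int.one_le_abs ht
  have hr2 := sq_abs r
  have ht2 := sq_abs t
  rcases h8 with h8 | h8
  · have := Int.le_of_dvd (abs_pos.mpr hr) ((abs_dvd_abs _ _).mpr h8)
    nlinarith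
  · have := Int.le_of_dvd (abs_pos.mpr ht) ((abs_dvd_abs _ _).mpr h8)
    nlinarith

theorem eq_zero_or_eq_zero_of_concordant_of_isCoprime {X Y Z W : ℤ} (hXY : IsCoprime X Y)
    (h1 : X ^ 2 + Y ^ 2 = Z ^ 2) (h2 : X ^ 2 + 9 * Y ^ 2 = W ^ 2) : X = 0 ∨ Y = 0 := by
  induction hn : Z.natAbs using Nat.strong_induction_on generalizing X Y Z W with
  | _ n ih =>
    by_contra! h0
    obtain ⟨X', Y', Z', W', h3, h4, h5, h6, h7, h8⟩ := concordant_descent h0.1 h0.2 hXY h1 h2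
    rcases ih _ (hn ▸ h8) h5 h6 h7 rfl with h | h
    · exact h3 h
    · exact h4 h

/-- `1` and `9` are discordant: `X² + Y²` and `X² + 9Y²` are both squares only if `XY = 0`. -/
theorem eq_zero_or_eq_zero_of_concordant {X Y Z W : ℤ}
    (h1 : X ^ 2 + Y ^ 2 = Z ^ 2) (h2 : X ^ 2 + 9 * Y ^ 2 = W ^ 2) : X = 0 ∨ Y = 0 := by
  by_cases hX : X = 0
  · exact Or.inl hX
  have hpos : 0 < X.gcd Y := Int.gcd_pos_of_ne_zero_left Y hX
  obtain ⟨g, x, y, hg, hgcd, rfl, rfl⟩ : ∃ g x y : ℤ, g ≠ 0 ∧ x.gcd y = 1 ∧ X = g * x ∧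
      Y = g * y := by
    obtain ⟨x, y, h, hx, hy⟩ := Int.exists_gcd_one hpos
    exact ⟨X.gcd Y, x, y, by exact_mod_cast hpos.ne', h, by rw [mul_comm]; exact hx,
      by rw [mul_comm]; exact hy⟩
  obtain ⟨z, rfl⟩ : g ∣ Z :=
    (Int.pow_dvd_pow_iff two_ne_zero).mp ⟨x ^ 2 + y ^ 2, by rw [← h1]; ring⟩
  obtain ⟨w, rfl⟩ : g ∣ W :=
    (Int.pow_dvd_pow_iff two_ne_zero).mp ⟨x ^ 2 + 9 * y ^ 2, by rw [← h2]; ring⟩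
  have hg2 := pow_ne_zero 2 hg
  rcases eq_zero_or_eq_zero_of_concordant_of_isCoprime (Int.isCoprime_iff_gcd_eq_one.mpr hgcd)
    (Z := z) (W := w) (mul_left_cancel₀ hg2 (by linear_combination h1))
    (mul_left_cancel₀ hg2 (by linear_combination h2)) with h | h
  · exact Or.inl (by rw [h, mul_zero])
  · exact Or.inr (by rw [h, mul_zero])

theorem Polynomial.irreducible_biquadratic {F : Type*} [Field F] {b c : F}
    (hdisc : ¬ IsSquare (b ^ 2 + 4 * c)) (hc : ¬ IsSquare (-c)) :
    Irreducible (X ^ 4 + C b * X ^ 2 - C c : F[X]) := by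
  have hdeg : (X ^ 4 + C b * X ^ 2 - C c : F[X]).natDegree = 4 := by compute_degree!
  have hmon : (X ^ 4 + C b * X ^ 2 - C c : F[X]).Monic := by monicity!
  rw [hmon.irreducible_iff_lt_natDegree_lt (fun h => by rw [h] at hdeg; simp at hdeg), hdeg]
  intro q hq hqdeg hdvd
  have hq12 : q.natDegree = 1 ∨ q.natDegree = 2 := by
    simp only [Finset.mem_Ioc] at hqdeg
    omega
  rcases hq12 with hq1 | hq2
  · obtain ⟨x, hx⟩ := Polynomial.exists_root_of_degree_eq_one
      (by rw [degree_eq_natDegree hq.ne_zero, hq1]; rfl : q.degree = 1)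
    have hroot := hx.dvd hdvd
    simp only [IsRoot.def, eval_sub, eval_add, eval_pow, eval_X, eval_mul, eval_C] at hroot
    exact hdisc ⟨2 * x ^ 2 + b, by linear_combination (-4) * hroot⟩
  · obtain ⟨s, hs⟩ := hdvd
    have hsmon : s.Monic := hq.of_mul_monic_left (hs ▸ hmon)
    have hsdeg : s.natDegree = 2 := by
      have := hq.natDegree_mul hsmon
      rw [← hs, hdeg, hq2] at this
      omega
    have quad : ∀ p : F[X], p.Monic → p.natDegree = 2 →
        p = X ^ 2 + C (p.coeff 1) * X + C (p.coeff 0) := by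
      intro p hp hp2
      conv_lhs => rw [hp.as_sum, hp2]
      simp [Finset.sum_range_succ]
      ring
    set α := q.coeff 1
    set β := q.coeff 0
    set γ := s.coeff 1
    set δ := s.coeff 0
    have hprod : (X ^ 4 + C b * X ^ 2 - C c : F[X]) = X ^ 4 + C (α + γ) * X ^ 3 +
        C (β + δ + α * γ) * X ^ 2 + C (α * δ + β * γ) * X + C (β * δ) := by
      rw [hs, quad q hq hq2, quad s hsmon hsdeg]
      simp only [C_add, C_mul]
      ring
    have e0 := congrArg (fun p => p.coeff 0) hprod
    have e1 := congrArg (fun p => p.coeff 1) hprod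
    have e2 := congrArg (fun p => p.coeff 2) hprod
    have e3 := congrArg (fun p => p.coeff 3) hprod
    simp only [coeff_add, coeff_sub, coeff_C_mul, coeff_X_pow, coeff_X, coeff_C] at e0 e1 e2 e3
    norm_num at e0 e1 e2 e3
    have hγ : γ = -α := by linear_combination -e3
    rw [hγ] at e1 e2
    have hαδ : α * (δ - β) = 0 := by linear_combination -e1
    rcases mul_eq_zero.mp hαδ with h | h
    · rw [h] at e2
      exact hdisc ⟨β - δ, by rw [e2]; linear_combination (-4) * e0⟩
    · exact hc ⟨β, by linear_combination e0 + β * h⟩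

theorem exists_rat_eq_add_mul_sqrt_two (x : K) :
    ∃ p q : ℚ, (x : ℝ) = p + q * Real.sqrt 2 := by
  have h2 : Real.sqrt 2 ^ 2 = 2 := Real.sq_sqrt (by norm_num)
  obtain ⟨x, hx⟩ := x
  change x ∈ IntermediateField.adjoin ℚ {Real.sqrt 2} at hx
  change ∃ p q : ℚ, x = p + q * Real.sqrt 2
  induction hx using IntermediateField.adjoin_induction with
  | mem x hx => exact ⟨0, 1, by rw [Set.mem_singleton_iff.mp hx]; simp⟩
  | algebraMap x => exact ⟨x, 0, by simp⟩
  | add x y _ _ hx hy =>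
    obtain ⟨p, q, rfl⟩ := hx
    obtain ⟨p', q', rfl⟩ := hy
    exact ⟨p + p', q + q', by push_cast; ring⟩
  | mul x y _ _ hx hy =>
    obtain ⟨p, q, rfl⟩ := hx
    obtain ⟨p', q', rfl⟩ := hy
    exact ⟨p * p' + 2 * q * q', p * q' + q * p', by push_cast; linear_combination q * q' * h2⟩
  | inv x _ hx =>
    obtain ⟨p, q, rfl⟩ := hx
    by_cases h0 : (p : ℝ) + q * Real.sqrt 2 = 0
    · exact ⟨0, 0, by rw [h0]; simp⟩
    have h1 : (p : ℝ) ^ 2 - 2 * q ^ 2 ≠ 0 := by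
      intro h
      have h' : ((p : ℝ) + q * Real.sqrt 2) * (p - q * Real.sqrt 2) = 0 := by
        linear_combination h - q ^ 2 * h2
      have hp : (p : ℝ) = q * Real.sqrt 2 := by
        linear_combination (mul_eq_zero.mp h').resolve_left h0
      by_cases hq : q = 0
      · simp_all
      · exact irrational_sqrt_two ⟨p / q, by push_cast; rw [hp]; field_simp⟩
    refine ⟨p / (p ^ 2 - 2 * q ^ 2), -q / (p ^ 2 - 2 * q ^ 2), ?_⟩
    push_cast
    apply inv_eq_of_mul_eq_one_right
    linear_combination mul_inv_cancel₀ h1 - q ^ 2 * ((p : ℝ) ^ 2 - 2 * q ^ 2)⁻¹ * h2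

theorem eq_and_eq_of_add_mul_sqrt_two_eq {p q p' q' : ℚ}
    (h : (p : ℝ) + q * Real.sqrt 2 = p' + q' * Real.sqrt 2) : p = p' ∧ q = q' := by
  have hq : q = q' := by
    by_contra hq
    have : (q : ℝ) - q' ≠ 0 := sub_ne_zero.mpr (by exact_mod_cast hq)
    refine irrational_sqrt_two ⟨(p' - p) / (q - q'), ?_⟩
    push_cast
    field_simp
    linear_combination -h
  subst hq
  exact ⟨by exact_mod_cast add_right_cancel h, rfl⟩

theorem sq_sub_sq_sq_ne {a u : ℤ} (ha : a ≠ 0) :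
    (u ^ 2 - a ^ 2) ^ 2 - (2 * a * u) ^ 2 ≠ 0 := by
  have key : ∀ v : ℤ, v ^ 2 ≠ 2 * a ^ 2 := by
    intro v hv
    have h2 : (v / a : ℝ) ^ 2 = 2 := by
      have : (v : ℝ) ^ 2 = 2 * a ^ 2 := by exact_mod_cast hv
      have ha' : (a : ℝ) ≠ 0 := by exact_mod_cast ha
      rw [div_pow, this]
      field_simp
    have h3 : Real.sqrt 2 = |(v / a : ℝ)| := by rw [← h2, Real.sqrt_sq_eq_abs]
    exact irrational_sqrt_two ⟨|(v / a : ℚ)|, by rw [h3]; push_cast; rfl⟩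
  intro h
  have h' : ((u - a) ^ 2 - 2 * a ^ 2) * ((u + a) ^ 2 - 2 * a ^ 2) = 0 := by
    linear_combination h
  rcases mul_eq_zero.mp h' with h | h
  · exact key (u - a) (by linarith)
  · exact key (u + a) (by linarith)

theorem not_isSquare_norm {a u : ℤ} (ha : a ≠ 0) (hu : u ≠ 0) (hau : u ^ 2 - a ^ 2 ≠ 0) :
    ¬ IsSquare ((u ^ 2 - a ^ 2) ^ 4 + 34 * (u ^ 2 - a ^ 2) ^ 2 * (2 * a * u) ^ 2 +
      (2 * a * u) ^ 4) := by
  rintro ⟨w, hw⟩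
  rcases eq_zero_or_eq_zero_of_concordant
    (X := (u ^ 2 - a ^ 2) ^ 2 - (2 * a * u) ^ 2) (Y := 2 * (u ^ 2 - a ^ 2) * (2 * a * u))
    (Z := (u ^ 2 - a ^ 2) ^ 2 + (2 * a * u) ^ 2) (W := w) (by ring)
    (by linear_combination hw) with h | h
  · exact sq_sub_sq_sq_ne ha h
  · simp_all

theorem not_isSquare_discriminant {a u : ℤ} (ha : a ≠ 0) (hu : u ≠ 0) (hau : u ^ 2 - a ^ 2 ≠ 0)
    {e : ℤ} (he : e ^ 2 = 1) :
    ¬ IsSquare (((3 + e * 2 * sqrt2) * ((u : K) ^ 2 - (a : K) ^ 2)) ^ 2 +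
      4 * ((a : K) ^ 2 * (u : K) ^ 2)) := by
  rintro ⟨x, hx⟩
  obtain ⟨p, q, hpq⟩ := exists_rat_eq_add_mul_sqrt_two x
  have h2 : Real.sqrt 2 ^ 2 = 2 := Real.sq_sqrt (by norm_num)
  have he' : (e : ℝ) ^ 2 = 1 := by exact_mod_cast he
  have heq : (e : ℚ) ^ 2 = 1 := by exact_mod_cast he
  have hx' := congrArg (Subtype.val : K → ℝ) hx
  have hs : (sqrt2 : ℝ) = Real.sqrt 2 := rfl
  push_cast at hx'
  rw [hpq, hs, show ((2 : K) : ℝ) = 2 from rfl, show ((3 : K) : ℝ) = 3 from rfl,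
    show ((4 : K) : ℝ) = 4 from rfl] at hx'
  obtain ⟨h3, h4⟩ := eq_and_eq_of_add_mul_sqrt_two_eq
    (p := 17 * ((u : ℚ) ^ 2 - a ^ 2) ^ 2 + 4 * (a ^ 2 * u ^ 2))
    (q := 12 * e * ((u : ℚ) ^ 2 - a ^ 2) ^ 2) (p' := p ^ 2 + 2 * q ^ 2) (q' := 2 * p * q) (by
      push_cast
      linear_combination hx' + (q ^ 2 - 4 * e ^ 2 * ((u : ℝ) ^ 2 - a ^ 2) ^ 2) * h2
        - 8 * ((u : ℝ) ^ 2 - a ^ 2) ^ 2 * he')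
  refine not_isSquare_norm ha hu hau (Rat.isSquare_intCast_iff.mp ⟨p ^ 2 - 2 * q ^ 2, ?_⟩)
  push_cast
  linear_combination (17 * ((u : ℚ) ^ 2 - a ^ 2) ^ 2 + 4 * (a ^ 2 * u ^ 2) + p ^ 2 + 2 * q ^ 2) * h3
    - 2 * (12 * e * ((u : ℚ) ^ 2 - a ^ 2) ^ 2 + 2 * p * q) * h4
    + 288 * ((u : ℚ) ^ 2 - a ^ 2) ^ 4 * heq

theorem irreducible_biquadratic_sqrt_two {a u : ℕ} (ha : 0 < a) (hu : 0 < u) (hau : a ≠ u)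
    {e : ℤ} (he : e ^ 2 = 1) :
    Irreducible (X ^ 4 + C ((3 + e * 2 * sqrt2) * ((u : K) ^ 2 - (a : K) ^ 2)) * X ^ 2 -
      C ((a : K) ^ 2 * (u : K) ^ 2) : K[X]) := by
  apply Polynomial.irreducible_biquadratic
  · refine not_isSquare_discriminant (a := a) (u := u) ?_ ?_ ?_ he
    · exact_mod_cast ha.ne'
    · exact_mod_cast hu.ne'
    · rw [sub_ne_zero]
      intro h
      exact hau (Nat.pow_left_injective two_ne_zero (by exact_mod_cast h.symm))
  · rintro ⟨x, hx⟩
    have hx' := congrArg (Subtype.val : K → ℝ) hx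
    push_cast at hx'
    have h1 : (0 : ℝ) < (a : ℝ) ^ 2 * (u : ℝ) ^ 2 := by positivity
    nlinarith [mul_self_nonneg (x : ℝ)]

/-- `H₋` and `H₊` are irreducible in `K[t]`. -/
theorem stmt_14 (a u : ℕ) (ha : 0 < a) (hu : 0 < u) (hau : a ≠ u) (hcop : Nat.Coprime a u)
    (Δ A₀ : K) (hΔ : Δ = (u : K) ^ 2 - (a : K) ^ 2) (hA₀ : A₀ = (a : K) ^ 2 * (u : K) ^ 2) :
    Irreducible (X ^ 4 + C ((3 - 2 * sqrt2) * Δ) * X ^ 2 - C A₀ : K[X]) ∧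
      Irreducible (X ^ 4 + C ((3 + 2 * sqrt2) * Δ) * X ^ 2 - C A₀ : K[X]) := by
  subst hΔ hA₀
  constructor
  · convert irreducible_biquadratic_sqrt_two ha hu hau (e := -1) (by norm_num) using 6
    push_cast
    ring
  · convert irreducible_biquadratic_sqrt_two ha hu hau (e := 1) (by norm_num) using 6
    push_cast
    ring
end
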